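/- arXiv:2402.14450 — 2 statements merged into one kernel-verified Lean document; each statement's English description precedes it below -/
import Mathlib

section
/- Every finite-player game in which each player i has a finite strategy set S_i and a payoff function U_i : ∏_j S_j → ℝ admits a Nash equilibrium in mixed strategies: there exists a profile σ* = (σ*_1, …, σ*_n) of probability distributions σ*_i ∈ Δ(S_i) such that for every player i and every σ_i ∈ Δ(S_i), the expected payoff satisfies U_i(σ_i, σ*_{−i}) ≤ U_i(σ*). -/
/-- A mixed strategy on a finite strategy set: a nonnegative weight function summing to 1. -/
def IsMixedStrategy {S : Type*} [Fintype S] (σ : S → ℝ) : Prop :=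
  (∀ s, 0 ≤ σ s) ∧ ∑ s, σ s = 1

/-- Expected payoff of player `i` under the mixed strategy profile `σ` (multilinear
extension of the payoff function `U i`). -/
def expectedPayoff {ι : Type*} [Fintype ι] [DecidableEq ι] {S : ι → Type*} [∀ i, Fintype (S i)]
    (U : ι → (∀ j, S j) → ℝ) (σ : ∀ j, S j → ℝ) (i : ι) : ℝ :=
  ∑ s : ∀ j, S j, U i s * ∏ j, σ j (s j)



section Brouwer
open MeasureTheory Metric Set Filter Topology
open scoped NNReal Manifold

variable {E : Type*} [NormedAddCommGroup E] [InnerProductSpace ℝ E] [FiniteDimensional ℝ E]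

/-- `det (1 + t A)` is a polynomial in `t` of degree at most the dimension. -/
lemma nashAux_poly (A : E →L[ℝ] E) : ∃ p : Polynomial ℝ, p.natDegree ≤ Module.finrank ℝ E ∧
    ∀ t : ℝ, p.eval t = (ContinuousLinearMap.id ℝ E + t • A).det := by
  classical
  let b := Module.finBasis ℝ E
  let M := LinearMap.toMatrix b b (A : E →ₗ[ℝ] E)
  refine ⟨Matrix.det ((Polynomial.X : Polynomial ℝ) • M.map Polynomial.C +
    (1 : Matrix _ _ ℝ).map Polynomial.C), ?_, fun t => ?_⟩
  · simpa using Polynomial.natDegree_det_X_add_C_le M 1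
  · rw [ContinuousLinearMap.det, ← LinearMap.det_toMatrix b]
    rw [← Polynomial.coe_evalRingHom, RingHom.map_det]
    congr 1
    ext i j
    simp [M, LinearMap.toMatrix_apply, Matrix.one_apply, Finsupp.single_apply, eq_comm]
    split_ifs <;> simp [add_comm, mul_comm]

/-- Lagrange extrapolation: the value at `1` from values at small nodes. -/
lemma nashAux_extrap (n : ℕ) (δ : ℝ) (hδ : 0 < δ) : ∃ (v c : Fin (n + 1) → ℝ),
    (∀ k, v k ∈ Ioo 0 δ) ∧ ∀ p : Polynomial ℝ, p.natDegree ≤ n →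
      p.eval 1 = ∑ k, c k * p.eval (v k) := by
  let v : Fin (n + 1) → ℝ := fun k => δ / ((k : ℕ) + 2)
  have hv : Function.Injective v := by
    intro a b hab
    simp only [v] at hab
    have ha : (0 : ℝ) < (a : ℕ) + 2 := by positivity
    have hb : (0 : ℝ) < (b : ℕ) + 2 := by positivity
    rw [div_eq_div_iff ha.ne' hb.ne'] at hab
    have := mul_left_cancel₀ hδ.ne' hab
    apply Fin.ext
    have h2 : ((a : ℕ) : ℝ) = (b : ℕ) := by linarith
    exact_mod_cast h2
  refine ⟨v, fun k => (Lagrange.basis Finset.univ v k).eval 1, fun k => ⟨by positivity, ?_⟩, ?_⟩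
  · simp only [v]
    rw [div_lt_iff₀ (by positivity)]
    have : (0 : ℝ) ≤ (k : ℕ) := by positivity
    nlinarith
  · intro p hp
    have hdeg : p.degree < (Finset.univ : Finset (Fin (n + 1))).card := by
      rw [Finset.card_univ, Fintype.card_fin]
      exact lt_of_le_of_lt Polynomial.degree_le_natDegree (by exact_mod_cast Nat.lt_succ_of_le hp)
    have h := Lagrange.eq_interpolate (s := Finset.univ) (v := v) (hv.injOn) hdeg
    conv_lhs => rw [h]
    simp [Lagrange.interpolate_apply, Polynomial.eval_finsetSum, mul_comm]

section Volume

variable [MeasurableSpace E] [BorelSpace E]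

lemma nashAux_vol (g : E → E) (L : ℝ≥0) (hL : LipschitzWith L g) (ρ : ℝ)
    (hg0 : ∀ x, ρ ≤ ‖x‖ → g x = 0) (hd : ∀ x ∈ ball (0 : E) ρ, DifferentiableAt ℝ g x) :
    ∃ δ > 0, ∀ t ∈ Ioo (0 : ℝ) δ,
      ∫ x in ball (0 : E) ρ, (ContinuousLinearMap.id ℝ E + t • fderiv ℝ g x).det
        = volume.real (ball (0 : E) ρ) := by
  obtain ⟨ε, hε, hεdet⟩ : ∃ ε > 0, ∀ B : E →L[ℝ] E,
      dist B (ContinuousLinearMap.id ℝ E) < ε → 0 < B.det := by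
    have hc := (ContinuousLinearMap.continuous_det (𝕜 := ℝ) (E := E)).continuousAt
      (x := ContinuousLinearMap.id ℝ E)
    have h1 : (0 : ℝ) < (ContinuousLinearMap.id ℝ E).det := by simp [ContinuousLinearMap.det]
    exact Metric.eventually_nhds_iff.1 (hc.eventually (lt_mem_nhds h1))
  have hL0 : (0 : ℝ) ≤ L := L.2
  refine ⟨min ε 1 / (L + 1), by positivity, fun t ht => ?_⟩
  have htL : t * (L + 1) < min ε 1 := by
    have := ht.2
    rwa [lt_div_iff₀ (by positivity)] at this
  have ht0 := ht.1
  have htε : t * L < ε := by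
    have := min_le_left ε 1
    nlinarith
  have ht1 : t * L < 1 := by
    have := min_le_right ε 1
    nlinarith
  let f : E → E := fun x => x + t • g x
  have hbij : Function.Bijective f := by
    have happ : ApproximatesLinearOn f ((ContinuousLinearEquiv.refl ℝ E : E ≃L[ℝ] E) : E →L[ℝ] E)
        univ (t.toNNReal * L) := by
      rw [ApproximatesLinearOn.approximatesLinearOn_iff_lipschitzOnWith]
      have : f - ⇑((ContinuousLinearEquiv.refl ℝ E : E ≃L[ℝ] E) : E →L[ℝ] E) =
          fun x => t • g x := by
        ext x; simp [f]
      rw [this, lipschitzOnWith_univ]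
      refine LipschitzWith.of_dist_le_mul fun x y => ?_
      rw [dist_smul₀, Real.norm_of_nonneg ht0.le]
      have := hL.dist_le_mul x y
      push_cast
      rw [Real.coe_toNNReal _ ht0.le, mul_assoc]
      gcongr
    have hc : Subsingleton E ∨ t.toNNReal * L <
        ‖((ContinuousLinearEquiv.refl ℝ E).symm : E →L[ℝ] E)‖₊⁻¹ := by
      rcases subsingleton_or_nontrivial E with h | h
      · exact Or.inl h
      · right
        have : ‖((ContinuousLinearEquiv.refl ℝ E).symm : E →L[ℝ] E)‖₊ = 1 := by
          ext; simp
        rw [this, ← NNReal.coe_lt_coe]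
        push_cast
        rw [Real.coe_toNNReal _ ht0.le]
        simpa using ht1
    exact (happ.toHomeomorph f hc).bijective
  have hout : ∀ x, ρ ≤ ‖x‖ → f x = x := fun x hx => by simp [f, hg0 x hx]
  have himg : f '' ball 0 ρ = ball 0 ρ := by
    ext y
    constructor
    · rintro ⟨x, hx, rfl⟩
      by_contra hy
      simp only [mem_ball_zero_iff, not_lt] at hx hy
      have := hbij.1 (hout _ hy)
      rw [this] at hy
      linarith
    · intro hy
      obtain ⟨x, rfl⟩ := hbij.2 y
      refine ⟨x, ?_, rfl⟩
      by_contra hx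
      simp only [mem_ball_zero_iff, not_lt] at hx hy
      rw [hout x hx] at hy
      linarith
  have hder : ∀ x ∈ ball (0 : E) ρ, HasFDerivWithinAt f
      (ContinuousLinearMap.id ℝ E + t • fderiv ℝ g x) (ball 0 ρ) x := fun x hx =>
    ((hasFDerivAt_id x).add ((hd x hx).hasFDerivAt.const_smul t)).hasFDerivWithinAt
  have key := integral_image_eq_integral_abs_det_fderiv_smul volume measurableSet_ball hder
    hbij.1.injOn (fun _ => (1 : ℝ))
  rw [himg] at key
  simp only [smul_eq_mul, mul_one, integral_const, MeasurableSet.univ, measureReal_restrict_apply,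
    univ_inter] at key
  rw [key]
  refine setIntegral_congr_fun measurableSet_ball fun x hx => ?_
  refine (abs_of_pos (hεdet _ ?_)).symm
  rw [dist_eq_norm, add_sub_cancel_left, norm_smul, Real.norm_of_nonneg ht0.le]
  refine lt_of_le_of_lt ?_ htε
  gcongr
  exact norm_fderiv_le_of_lipschitz ℝ hL

/-- The volume identity extrapolated to `t = 1`. -/
lemma nashAux_vol_one (g : E → E) (L : ℝ≥0) (hL : LipschitzWith L g) (ρ : ℝ)
    (hg0 : ∀ x, ρ ≤ ‖x‖ → g x = 0) (hd : ∀ x ∈ ball (0 : E) ρ, DifferentiableAt ℝ g x) :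
    ∫ x in ball (0 : E) ρ, (ContinuousLinearMap.id ℝ E + fderiv ℝ g x).det
        = volume.real (ball (0 : E) ρ) := by
  obtain ⟨δ, hδ, hvol⟩ := nashAux_vol g L hL ρ hg0 hd
  obtain ⟨v, c, hv, hc⟩ := nashAux_extrap (Module.finrank ℝ E) δ hδ
  have hdet : ∀ A : E →L[ℝ] E, (ContinuousLinearMap.id ℝ E + A).det =
      ∑ k, c k * (ContinuousLinearMap.id ℝ E + v k • A).det := by
    intro A
    obtain ⟨p, hp, hpe⟩ := nashAux_poly A
    have := hc p hp
    simpa only [hpe, one_smul] using this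
  have hint : ∀ t : ℝ, IntegrableOn
      (fun x => (ContinuousLinearMap.id ℝ E + t • fderiv ℝ g x).det) (ball (0 : E) ρ) volume := by
    intro t
    have hcont : Continuous fun A : E →L[ℝ] E => (ContinuousLinearMap.id ℝ E + t • A).det :=
      ContinuousLinearMap.continuous_det.comp (by fun_prop)
    obtain ⟨C, hC⟩ := (isCompact_closedBall (0 : E →L[ℝ] E) L).exists_bound_of_continuousOn
      hcont.continuousOn
    refine Measure.integrableOn_of_bounded (M := C) measure_ball_lt_top.ne ?_ ?_
    · exact (hcont.measurable.comp (measurable_fderiv ℝ g)).aestronglyMeasurable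
    · refine Eventually.of_forall fun x => hC _ ?_
      rw [mem_closedBall_zero_iff]
      exact norm_fderiv_le_of_lipschitz ℝ hL
  rw [integral_congr_ae (ae_of_all _ fun x => hdet (fderiv ℝ g x))]
  rw [integral_finsetSum _ fun k _ => (hint (v k)).const_mul (c k)]
  simp_rw [integral_const_mul]
  have h1 := hc 1 (by simp)
  simp only [Polynomial.eval_one, mul_one] at h1
  calc _ = ∑ k, c k * volume.real (ball (0 : E) ρ) :=
        Finset.sum_congr rfl fun k _ => by rw [hvol _ (hv k)]
    _ = _ := by rw [← Finset.sum_mul, ← h1, one_mul]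

end Volume

/-- Gluing: Lipschitz on a ball and zero outside. -/
lemma nashAux_glue (g : E → E) (L : ℝ≥0) (ρ : ℝ) (hL : LipschitzOnWith L g (closedBall 0 ρ))
    (hg0 : ∀ x, ρ ≤ ‖x‖ → g x = 0) : LipschitzWith L g := by
  have key : ∀ x y : E, ‖x‖ ≤ ρ → ρ ≤ ‖y‖ → dist (g x) (g y) ≤ L * dist x y := by
    intro x y hx hy
    have hc : ContinuousOn (fun t : ℝ => ‖AffineMap.lineMap x y t‖) (Icc 0 1) := by
      apply Continuous.continuousOn
      exact continuous_norm.comp AffineMap.lineMap_continuous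
    obtain ⟨t, ht, hz⟩ := intermediate_value_Icc zero_le_one hc
      (show ρ ∈ Icc _ _ by simpa using ⟨hx, hy⟩)
    simp only at hz
    have h1 := hL.dist_le_mul x (by simpa using hx) (AffineMap.lineMap x y t) (by simp [hz])
    rw [hg0 _ hz.ge] at h1
    rw [hg0 y hy]
    refine h1.trans ?_
    gcongr
    rw [dist_left_lineMap, Real.norm_of_nonneg ht.1]
    exact mul_le_of_le_one_left dist_nonneg ht.2
  refine LipschitzWith.of_dist_le_mul fun x y => ?_
  rcases le_total ‖x‖ ρ with hx | hx <;> rcases le_total ‖y‖ ρ with hy | hy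
  · exact hL.dist_le_mul x (by simpa using hx) y (by simpa using hy)
  · exact key x y hx hy
  · rw [dist_comm, dist_comm x]; exact key y x hy hx
  · rw [hg0 x hx, hg0 y hy, dist_self]; positivity

/-- No nonvanishing smooth map equal to the identity outside a ball. -/
lemma nashAux_noret (H : E → E) (hH : ContDiff ℝ 1 H) (ρ : ℝ) (hρ : 0 < ρ)
    (h0 : ∀ x, H x ≠ 0) (hid : ∀ x, ρ ≤ ‖x‖ → H x = x) : False := by
  let _ : MeasurableSpace E := borel E
  have : BorelSpace E := ⟨rfl⟩
  let h : E → E := fun x => (ρ * ‖H x‖⁻¹) • H x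
  have hsm : ContDiff ℝ 1 h := by
    refine ContDiff.smul (contDiff_const.mul ?_) hH
    exact (hH.norm ℝ h0).inv fun x => by simpa using h0 x
  have hnorm : ∀ x, ‖h x‖ = ρ := by
    intro x
    have : ‖H x‖ ≠ 0 := by simpa using h0 x
    simp only [h, norm_smul, norm_mul, norm_inv, norm_norm, Real.norm_of_nonneg hρ.le]
    field_simp
  classical
  let g : E → E := fun x => if ρ ≤ ‖x‖ then 0 else h x - x
  have hgin : ∀ x ∈ closedBall (0 : E) ρ, g x = h x - x := by
    intro x hx
    simp only [mem_closedBall_zero_iff] at hx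
    by_cases hx' : ρ ≤ ‖x‖
    · have : ‖x‖ = ρ := le_antisymm hx hx'
      simp [g, h, hid x hx', this, hρ.ne']
    · simp [g, hx']
  have hg0 : ∀ x, ρ ≤ ‖x‖ → g x = 0 := fun x hx => by simp [g, hx]
  obtain ⟨L, hL⟩ := (hsm.sub contDiff_id).contDiffOn.exists_lipschitzOnWith one_ne_zero
    (convex_closedBall (0 : E) ρ) (isCompact_closedBall (0 : E) ρ)
  have hL' : LipschitzWith L g := by
    refine nashAux_glue g L ρ ?_ hg0
    intro x hx y hy
    rw [hgin x hx, hgin y hy]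
    exact hL hx hy
  have hder : ∀ x ∈ ball (0 : E) ρ,
      HasFDerivAt g (fderiv ℝ h x - ContinuousLinearMap.id ℝ E) x := by
    intro x hx
    have h1 : HasFDerivAt (fun x => h x - x) (fderiv ℝ h x - ContinuousLinearMap.id ℝ E) x :=
      ((hsm.differentiable one_ne_zero x).hasFDerivAt).sub (hasFDerivAt_id x)
    refine h1.congr_of_eventuallyEq ?_
    filter_upwards [isOpen_ball.mem_nhds hx] with y hy
    exact hgin y (ball_subset_closedBall hy)
  have key := nashAux_vol_one g L hL' ρ hg0 fun x hx => (hder x hx).differentiableAt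
  have hz : ∀ x ∈ ball (0 : E) ρ, (ContinuousLinearMap.id ℝ E + fderiv ℝ g x).det = 0 := by
    intro x hx
    rw [(hder x hx).fderiv, add_sub_cancel]
    by_contra hdet
    have hu : IsUnit (LinearMap.det (fderiv ℝ h x : E →ₗ[ℝ] E)) := isUnit_iff_ne_zero.2 hdet
    obtain ⟨w, hw⟩ := (LinearEquiv.ofIsUnitDet (v := Module.finBasis ℝ E)
      (v' := Module.finBasis ℝ E) (f := (fderiv ℝ h x : E →ₗ[ℝ] E))
      (by rwa [LinearMap.det_toMatrix])).surjective (h x)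
    have hw' : fderiv ℝ h x w = h x := hw
    have hd := (hsm.differentiable one_ne_zero x).hasFDerivAt
    have h2 := hd.norm_sq
    have h3 : HasFDerivAt (fun y => ‖h y‖ ^ 2) (0 : E →L[ℝ] ℝ) x := by
      simp only [hnorm]; exact hasFDerivAt_const _ _
    have h4 := congrArg (fun A : E →L[ℝ] ℝ => A w) (h2.unique h3)
    simp [hw', hnorm, hρ.ne'] at h4
  rw [setIntegral_congr_fun measurableSet_ball hz] at key
  simp only [integral_zero] at key
  have : 0 < volume.real (ball (0 : E) ρ) :=
    ENNReal.toReal_pos (measure_ball_pos _ _ hρ).ne' measure_ball_lt_top.ne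
  linarith

/-- Brouwer's fixed point theorem for bounded continuous self-maps. -/
lemma nashAux_brouwer (F : E → E) (hF : Continuous F) (R : ℝ) (hR : ∀ x, ‖F x‖ ≤ R) :
    ∃ x, F x = x := by
  by_contra hne
  push Not at hne
  have hR0 : 0 ≤ R := (norm_nonneg _).trans (hR 0)
  let t : E → Set E := fun x => {y | (‖x‖ ≤ R → y ∈ ball (F x) ‖x - F x‖) ∧
    (R < ‖x‖ → y ∈ ball 0 ‖x‖) ∧ (R + 1 ≤ ‖x‖ → y ∈ ({0} : Set E))}
  have himp : ∀ (p : Prop) (s : Set E), Convex ℝ s → Convex ℝ {y | p → y ∈ s} := by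
    intro p s hs
    by_cases hp : p
    · simpa [hp] using hs
    · simpa [hp] using convex_univ
  have ht : ∀ x, Convex ℝ (t x) := fun x =>
    (himp _ _ (convex_ball _ _)).inter ((himp _ _ (convex_ball _ _)).inter
      (himp _ _ (convex_singleton _)))
  have hloc : ∀ x : E, ∃ c : E, ∀ᶠ y in 𝓝 x, c ∈ t y := by
    intro x
    by_cases hx : ‖x‖ < R + 1
    · refine ⟨F x, ?_⟩
      have e1 : ∀ᶠ y in 𝓝 x, ‖F x - F y‖ < ‖y - F y‖ := by
        refine ContinuousAt.eventually_lt (by fun_prop) (by fun_prop) ?_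
        simpa [sub_eq_zero] using (hne x).symm
      have e2 : ∀ᶠ y in 𝓝 x, ‖y‖ < R + 1 := continuous_norm.continuousAt.eventually_lt_const hx
      filter_upwards [e1, e2] with y h1 h2
      refine ⟨fun _ => by simpa [dist_eq_norm] using h1, fun h => ?_, fun h => absurd h2 h.not_gt⟩
      rw [mem_ball_zero_iff]
      exact (hR x).trans_lt h
    · refine ⟨0, ?_⟩
      have e2 : ∀ᶠ y in 𝓝 x, R < ‖y‖ :=
        continuous_norm.continuousAt.eventually_const_lt (by linarith : R < ‖x‖)
      filter_upwards [e2] with y h2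
      refine ⟨fun h => absurd h2 h.not_gt, fun h => ?_, fun h => rfl⟩
      rw [mem_ball_zero_iff, norm_zero]
      linarith
  obtain ⟨G, hG⟩ := exists_contMDiffMap_forall_mem_convex_of_local_const (n := 1) 𝓘(ℝ, E) ht hloc
  refine nashAux_noret (fun x => x - G x) (contDiff_id.sub G.contMDiff.contDiff) (R + 1)
    (by linarith) ?_ ?_
  · intro x hx
    have hGx : G x = x := (sub_eq_zero.1 hx).symm
    obtain ⟨h1, h2, -⟩ := hG x
    rw [hGx] at h1 h2
    rcases le_or_gt ‖x‖ R with h | h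
    · simpa [dist_eq_norm] using h1 h
    · simpa using h2 h
  · intro x hx
    have : G x = 0 := (hG x).2.2 hx
    simp [this]

end Brouwer

section NashGame

variable {ι : Type*} [Fintype ι] [DecidableEq ι] {S : ι → Type*} [∀ i, Fintype (S i)]

open Classical in
/-- Payoff of player `i` when deviating to the pure strategy `s`. -/
noncomputable def nashAuxDev (U : ι → (∀ j, S j) → ℝ) (σ : ∀ j, S j → ℝ) (i : ι) (s : S i) : ℝ :=
  expectedPayoff U (Function.update σ i (Pi.single s 1)) i

lemma nashAux_update (U : ι → (∀ j, S j) → ℝ) (σ : ∀ j, S j → ℝ) (i : ι) (τ : S i → ℝ) :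
    expectedPayoff U (Function.update σ i τ) i =
      ∑ x : ∀ j, S j, τ (x i) * (U i x * ∏ j ∈ Finset.univ.erase i, σ j (x j)) := by
  unfold expectedPayoff
  refine Finset.sum_congr rfl fun x _ => ?_
  rw [← Finset.mul_prod_erase Finset.univ _ (Finset.mem_univ i), Function.update_self,
    Finset.prod_congr rfl fun j hj => by rw [Function.update_of_ne (Finset.ne_of_mem_erase hj)]]
  ring

lemma nashAux_lin (U : ι → (∀ j, S j) → ℝ) (σ : ∀ j, S j → ℝ) (i : ι) (τ : S i → ℝ) :
    expectedPayoff U (Function.update σ i τ) i = ∑ s, τ s * nashAuxDev U σ i s := by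
  classical
  simp only [nashAuxDev, nashAux_update, Finset.mul_sum]
  rw [Finset.sum_comm]
  refine Finset.sum_congr rfl fun x _ => ?_
  simp [Pi.single_apply]

/-- A continuous retraction of `S → ℝ` to the simplex. -/
noncomputable def nashAuxRet {T : Type*} [Fintype T] (x : T → ℝ) (s : T) : ℝ :=
  (max (x s) 0 + max (1 - ∑ u, max (x u) 0) 0 / Fintype.card T) / max 1 (∑ u, max (x u) 0)

lemma nashAuxRet_mixed {T : Type*} [Fintype T] [Nonempty T] (x : T → ℝ) :
    IsMixedStrategy (nashAuxRet x) := by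
  constructor
  · intro s; unfold nashAuxRet; positivity
  · unfold nashAuxRet
    have hc : (Fintype.card T : ℝ) ≠ 0 := by simp
    rw [← Finset.sum_div, Finset.sum_add_distrib, Finset.sum_const, Finset.card_univ, nsmul_eq_mul,
      mul_div_cancel₀ _ hc]
    rw [div_eq_one_iff_eq (by positivity)]
    rcases le_total 1 (∑ u, max (x u) 0) with h | h
    · rw [max_eq_right h, max_eq_right (by linarith), add_zero]
    · rw [max_eq_left h, max_eq_left (by linarith)]; ring

lemma nashAuxRet_eq {T : Type*} [Fintype T] (x : T → ℝ) (hx : IsMixedStrategy x) :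
    nashAuxRet x = x := by
  ext s
  have : ∑ u, max (x u) 0 = 1 := by
    rw [← hx.2]; exact Finset.sum_congr rfl fun u _ => max_eq_left (hx.1 u)
  simp [nashAuxRet, this, hx.1 s]

lemma nashAuxRet_continuous {T : Type*} [Fintype T] :
    Continuous (nashAuxRet : (T → ℝ) → T → ℝ) := by
  refine continuous_pi fun s => ?_
  unfold nashAuxRet
  refine Continuous.div (by fun_prop) (by fun_prop) fun x => ?_
  positivity

/-- Gain of player `i` from deviating to the pure strategy `s`. -/
noncomputable def nashAuxGain (U : ι → (∀ j, S j) → ℝ) (σ : ∀ j, S j → ℝ) (i : ι) (s : S i) : ℝ :=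
  max (nashAuxDev U σ i s - expectedPayoff U σ i) 0

lemma nashAuxGain_nonneg (U : ι → (∀ j, S j) → ℝ) (σ : ∀ j, S j → ℝ) (i : ι) (s : S i) :
    0 ≤ nashAuxGain U σ i s := le_max_right _ _

lemma nashAux_payoff_continuous (U : ι → (∀ j, S j) → ℝ) (i : ι) :
    Continuous fun σ : ∀ j, S j → ℝ => expectedPayoff U σ i := by
  unfold expectedPayoff
  fun_prop

lemma nashAuxGain_continuous (U : ι → (∀ j, S j) → ℝ) (i : ι) (s : S i) :
    Continuous fun σ : ∀ j, S j → ℝ => nashAuxGain U σ i s := by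
  have h := nashAux_payoff_continuous U i
  unfold nashAuxGain nashAuxDev
  exact ((h.comp (continuous_id.update i continuous_const)).sub h).max continuous_const

/-- Nash's improvement map. -/
noncomputable def nashAuxMap (U : ι → (∀ j, S j) → ℝ) (σ : ∀ j, S j → ℝ) (i : ι) (s : S i) : ℝ :=
  (σ i s + nashAuxGain U σ i s) / (1 + ∑ u, nashAuxGain U σ i u)

lemma nashAux_den (U : ι → (∀ j, S j) → ℝ) (σ : ∀ j, S j → ℝ) (i : ι) :
    0 < 1 + ∑ u, nashAuxGain U σ i u := by
  have := Finset.sum_nonneg fun u (_ : u ∈ Finset.univ) => nashAuxGain_nonneg U σ i u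
  linarith

lemma nashAuxMap_mixed (U : ι → (∀ j, S j) → ℝ) (σ : ∀ j, S j → ℝ)
    (hσ : ∀ i, IsMixedStrategy (σ i)) (i : ι) : IsMixedStrategy (nashAuxMap U σ i) := by
  constructor
  · intro s
    exact div_nonneg (add_nonneg ((hσ i).1 s) (nashAuxGain_nonneg U σ i s)) (nashAux_den U σ i).le
  · unfold nashAuxMap
    rw [← Finset.sum_div, Finset.sum_add_distrib, (hσ i).2, div_self (nashAux_den U σ i).ne']

lemma nashAuxMap_continuous (U : ι → (∀ j, S j) → ℝ) (i : ι) (s : S i) :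
    Continuous fun σ : ∀ j, S j → ℝ => nashAuxMap U σ i s := by
  have h := nashAuxGain_continuous U i
  unfold nashAuxMap
  refine Continuous.div (by fun_prop) (by fun_prop) fun x => (nashAux_den U x i).ne'

/-- Fixed points of Nash's map are equilibria. -/
lemma nashAux_fixed (U : ι → (∀ j, S j) → ℝ) (σ : ∀ j, S j → ℝ)
    (hσ : ∀ i, IsMixedStrategy (σ i)) (hfix : ∀ i s, nashAuxMap U σ i s = σ i s)
    (i : ι) (τ : S i → ℝ) (hτ : IsMixedStrategy τ) :
    expectedPayoff U (Function.update σ i τ) i ≤ expectedPayoff U σ i := by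
  set u := expectedPayoff U σ i with hu
  have hself : ∑ s, σ i s * nashAuxDev U σ i s = u := by
    rw [← nashAux_lin, Function.update_eq_self]
  have hz : ∑ s, σ i s * (nashAuxDev U σ i s - u) = 0 := by
    simp only [mul_sub, Finset.sum_sub_distrib, hself, ← Finset.sum_mul, (hσ i).2]
    ring
  have hg : ∀ s, nashAuxGain U σ i s = (∑ v, nashAuxGain U σ i v) * σ i s := by
    intro s
    have h := hfix i s
    rw [nashAuxMap, div_eq_iff (nashAux_den U σ i).ne'] at h
    linarith
  have hsq : ∑ s, nashAuxGain U σ i s ^ 2 = 0 := by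
    have : ∀ s, nashAuxGain U σ i s ^ 2 =
        (∑ v, nashAuxGain U σ i v) * (σ i s * (nashAuxDev U σ i s - u)) := by
      intro s
      rw [← mul_assoc, ← hg s]
      simp only [nashAuxGain, ← hu]
      rcases le_total (nashAuxDev U σ i s - u) 0 with h | h
      · simp [max_eq_right h]
      · rw [max_eq_left h]; ring
    rw [Finset.sum_congr rfl fun s _ => this s, ← Finset.mul_sum, hz, mul_zero]
  have hle : ∀ s, nashAuxDev U σ i s ≤ u := by
    intro s
    have h := (Finset.sum_eq_zero_iff_of_nonneg fun s _ => sq_nonneg _).1 hsq s (Finset.mem_univ s)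
    have h' : nashAuxGain U σ i s = 0 := by simpa using h
    have h2 := le_max_left (nashAuxDev U σ i s - expectedPayoff U σ i) 0
    change _ ≤ nashAuxGain U σ i s at h2
    linarith
  rw [nashAux_lin]
  calc _ ≤ ∑ s, τ s * u := Finset.sum_le_sum fun s _ => mul_le_mul_of_nonneg_left (hle s) (hτ.1 s)
    _ = u := by rw [← Finset.sum_mul, hτ.2, one_mul]

end NashGame

/-- Nash's theorem: every finite game admits a Nash equilibrium in mixed strategies. -/
theorem exists_nash_equilibrium_mixed
    {ι : Type*} [Fintype ι] [DecidableEq ι] [Nonempty ι]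
    (S : ι → Type*) [∀ i, Fintype (S i)] [∀ i, Nonempty (S i)]
    (U : ι → (∀ j, S j) → ℝ) :
    ∃ σstar : ∀ i, S i → ℝ,
      (∀ i, IsMixedStrategy (σstar i)) ∧
      ∀ i, ∀ σi : S i → ℝ, IsMixedStrategy σi →
        expectedPayoff U (Function.update σstar i σi) i ≤ expectedPayoff U σstar i := by
  let ret : EuclideanSpace ℝ (Σ i, S i) → ∀ i, S i → ℝ :=
    fun x i => nashAuxRet fun s => x ⟨i, s⟩
  have hret : ∀ x i, IsMixedStrategy (ret x i) := fun x i => nashAuxRet_mixed _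
  have hretc : Continuous ret := by
    refine continuous_pi fun i => nashAuxRet_continuous.comp ?_
    fun_prop
  let F : EuclideanSpace ℝ (Σ i, S i) → EuclideanSpace ℝ (Σ i, S i) :=
    fun x => WithLp.toLp 2 fun p => nashAuxMap U (ret x) p.1 p.2
  have hmix : ∀ x i, IsMixedStrategy (nashAuxMap U (ret x) i) := fun x i =>
    nashAuxMap_mixed U _ (hret x) i
  have hFc : Continuous F := by
    refine (PiLp.continuous_toLp 2 _).comp (continuous_pi fun p => ?_)
    exact (nashAuxMap_continuous U p.1 p.2).comp hretc
  have hFb : ∀ x, ‖F x‖ ≤ √(Fintype.card (Σ i, S i)) := by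
    intro x
    rw [EuclideanSpace.norm_eq]
    refine Real.sqrt_le_sqrt ?_
    calc _ ≤ ∑ _p : (Σ i, S i), (1 : ℝ) := by
          refine Finset.sum_le_sum fun p _ => ?_
          have h0 := (hmix x p.1).1 p.2
          have h1 : nashAuxMap U (ret x) p.1 p.2 ≤ 1 := by
            rw [← (hmix x p.1).2]
            exact Finset.single_le_sum (fun s _ => (hmix x p.1).1 s) (Finset.mem_univ p.2)
          change ‖nashAuxMap U (ret x) p.1 p.2‖ ^ 2 ≤ 1
          rw [Real.norm_of_nonneg h0]
          exact pow_le_one₀ h0 h1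
      _ = _ := by simp
  obtain ⟨x, hx⟩ := nashAux_brouwer F hFc _ hFb
  have hx' : ∀ i s, nashAuxMap U (ret x) i s = x ⟨i, s⟩ := fun i s =>
    congrArg (fun y : EuclideanSpace ℝ (Σ i, S i) => y ⟨i, s⟩) hx
  have hrx : ∀ i s, ret x i s = x ⟨i, s⟩ := by
    intro i s
    have hm : IsMixedStrategy fun s => x ⟨i, s⟩ := by
      have := hmix x i
      rwa [funext (hx' i)] at this
    exact congrFun (nashAuxRet_eq _ hm) s
  exact ⟨ret x, hret x, fun i τ hτ => nashAux_fixed U _ (hret x)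
    (fun i s => (hx' i s).trans (hrx i s).symm) i τ hτ⟩
end

section
/- Every Bayesian game with finitely many players, nested information F_n ⊆ ⋯ ⊆ F_1, compact metric action spaces A_i, payoff functions R_i : Ω × A → ℝ that are measurable, continuous in the action profile for every ω, and satisfy E[max_{a∈A} |R_i(a)|] < ∞, admits a Harsanyi ε-equilibrium for every ε > 0: a strategy profile s* such that for every player i and every strategy s_i, E_{(s_i, s*_{−i})}[R_i] ≤ E_{s*}[R_i] + ε. -/
open MeasureTheory

/-- The ex-ante (Harsanyi) expected payoff `E_s[R_i]` of player `i` under a profile `s` of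
behavior strategies with values in Borel probability measures on compact action spaces. -/
noncomputable def exAntePayoff {Ω : Type*} [MeasurableSpace Ω] (P : Measure Ω)
    {ι : Type*} [Fintype ι] {A : ι → Type*} [∀ i, MeasurableSpace (A i)]
    (R : ι → Ω → (∀ j, A j) → ℝ) (s : ∀ j, Ω → ProbabilityMeasure (A j)) (i : ι) : ℝ :=
  ∫ ω, ∫ a, R i ω a ∂(Measure.pi fun j => (s j ω : Measure (A j))) ∂P

open MeasureTheory

section Brouwer

variable {E : Type*} [NormedAddCommGroup E] [InnerProductSpace ℝ E] [FiniteDimensional ℝ E]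

lemma exists_convex_proj {K : Set E} (hne : K.Nonempty) (hc : IsClosed K) (hK : Convex ℝ K) :
    ∃ r : E → E, LipschitzWith 1 r ∧ (∀ x, r x ∈ K) ∧ (∀ x ∈ K, r x = x) ∧
      ∀ x, ∀ w ∈ K, inner ℝ (x - r x) (w - r x) ≤ 0 := by
  have h1 : ∀ u : E, ∃ v ∈ K, ∀ w ∈ K, inner ℝ (u - v) (w - v) ≤ 0 := by
    intro u
    obtain ⟨v, hv, h⟩ := exists_norm_eq_iInf_of_complete_convex hne hc.isComplete hK u
    exact ⟨v, hv, (norm_eq_iInf_iff_real_inner_le_zero hK hv).1 h⟩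
  choose r hr hin using h1
  refine ⟨r, ?_, hr, ?_, hin⟩
  · apply LipschitzWith.of_dist_le_mul
    intro x y
    simp only [NNReal.coe_one, one_mul, dist_eq_norm]
    have a1 := hin x (r y) (hr y)
    have a2 := hin y (r x) (hr x)
    have a3 : ‖r x - r y‖ ^ 2 ≤ inner ℝ (x - y) (r x - r y) := by
      rw [← real_inner_self_eq_norm_sq]
      have e1 : inner ℝ (x - r x) (r y - r x) = - inner ℝ (x - r x) (r x - r y) := by
        rw [← inner_neg_right, neg_sub]
      have e2 : inner ℝ (x - y) (r x - r y) - inner ℝ (r x - r y) (r x - r y) =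
          inner ℝ (x - r x) (r x - r y) - inner ℝ (y - r y) (r x - r y) := by
        rw [← inner_sub_left, ← inner_sub_left]; congr 1; abel
      linarith
    have a4 := real_inner_le_norm (x - y) (r x - r y)
    by_contra! hlt
    have : 0 < ‖r x - r y‖ := lt_of_le_of_lt (norm_nonneg _) hlt
    nlinarith
  · intro x hx
    have := hin x x hx
    rw [real_inner_self_eq_norm_sq] at this
    have h0 : ‖x - r x‖ = 0 := by nlinarith [norm_nonneg (x - r x)]
    exact (sub_eq_zero.1 (norm_eq_zero.1 h0)).symm

lemma exists_poly_det (D : E →L[ℝ] E) :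
    ∃ p : Polynomial ℝ, p.natDegree ≤ Module.finrank ℝ E ∧
      ∀ t : ℝ, p.eval t = (ContinuousLinearMap.id ℝ E + t • D).det := by
  let b := Module.finBasis ℝ E
  let M := LinearMap.toMatrix b b (D : E →ₗ[ℝ] E)
  refine ⟨((Polynomial.X : Polynomial ℝ) • M.map (Polynomial.C : ℝ →+* Polynomial ℝ) + (1 : Matrix (Fin (Module.finrank ℝ E)) (Fin (Module.finrank ℝ E)) ℝ).map (Polynomial.C : ℝ →+* Polynomial ℝ)).det, ?_, ?_⟩
  · simpa using Polynomial.natDegree_det_X_add_C_le M 1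
  · intro t
    have : (ContinuousLinearMap.id ℝ E + t • D).det
        = (LinearMap.toMatrix b b ((ContinuousLinearMap.id ℝ E + t • D : E →L[ℝ] E) : E →ₗ[ℝ] E)).det := by
      rw [LinearMap.det_toMatrix]
    rw [this, ← Polynomial.coe_evalRingHom, RingHom.map_det]
    congr 1
    ext i j
    simp [M, Matrix.add_apply, LinearMap.toMatrix_apply, Matrix.one_apply,
       Finsupp.single_apply, Matrix.map_apply]
    by_cases h : i = j
    · subst h; simp; try ring
    · have h' : ¬ j = i := fun e => h e.symm
      simp [h, h', mul_comm]

lemma det_pos_of_small (D : E →L[ℝ] E) (t : ℝ) (ht : 0 ≤ t) (h : t * ‖D‖ < 1) :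
    0 < (ContinuousLinearMap.id ℝ E + t • D).det := by
  have hcont : Continuous fun s : ℝ => (ContinuousLinearMap.id ℝ E + s • D).det :=
    ContinuousLinearMap.continuous_det.comp (by fun_prop)
  have hne : ∀ s ∈ Set.Icc (0:ℝ) t, (ContinuousLinearMap.id ℝ E + s • D).det ≠ 0 := by
    intro s hs h0
    have hk := LinearMap.bot_lt_ker_of_det_eq_zero (f := ((ContinuousLinearMap.id ℝ E + s • D : E →L[ℝ] E) : E →ₗ[ℝ] E)) h0
    obtain ⟨v, hv, hv0⟩ := (Submodule.ne_bot_iff _).1 hk.ne'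
    have hv' : v + s • D v = 0 := by simpa using hv
    have h1 : ‖v‖ ≤ s * (‖D‖ * ‖v‖) := by
      have : v = - (s • D v) := eq_neg_of_add_eq_zero_left hv'
      calc ‖v‖ = ‖s • D v‖ := by conv_lhs => rw [this, norm_neg]
        _ = s * ‖D v‖ := by rw [norm_smul, Real.norm_of_nonneg hs.1]
        _ ≤ _ := mul_le_mul_of_nonneg_left (D.le_opNorm v) hs.1
    have h2 : 0 < ‖v‖ := norm_pos_iff.2 hv0
    have h3 : s * ‖D‖ ≤ t * ‖D‖ := mul_le_mul_of_nonneg_right hs.2 (norm_nonneg _)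
    nlinarith
  by_contra! hle
  have h0 : (ContinuousLinearMap.id ℝ E + (0:ℝ) • D).det = 1 := by
    simp [ContinuousLinearMap.det]
  have := intermediate_value_Icc' ht hcont.continuousOn (show (0:ℝ) ∈ Set.Icc _ _ from ⟨hle, by simp only [h0]; norm_num⟩)
  obtain ⟨s, hs, hs0⟩ := this
  exact hne s hs hs0

open Metric in
lemma image_closedBall_of_small {g : E → E} {L : NNReal}
    (hL : LipschitzOnWith L g (closedBall 0 1)) (hg0 : ∀ x, ‖x‖ = 1 → g x = 0)
    (t : ℝ) (ht : 0 ≤ t) (htL : t * L < 1) :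
    Set.InjOn (fun x => x + t • g x) (closedBall 0 1) ∧
      (fun x => x + t • g x) '' (closedBall 0 1) = closedBall (0:E) 1 := by
  obtain ⟨r, hrl, hrB, hrid, hrin⟩ := exists_convex_proj (K := closedBall (0:E) 1)
    ⟨0, by simp⟩ isClosed_closedBall (convex_closedBall _ _)
  have hgL : LipschitzWith L (g ∘ r) := by
    have := LipschitzOnWith.comp hL (hrl.lipschitzOnWith (s := Set.univ)) (fun x _ => hrB x)
    simpa using this
  have hout : ∀ x, x ∉ closedBall (0:E) 1 → g (r x) = 0 := by
    intro x hx
    apply hg0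
    have h1 : ‖r x‖ ≤ 1 := by simpa using hrB x
    refine le_antisymm h1 ?_
    by_contra! hlt
    have hd : 0 < ‖x - r x‖ := by
      rw [norm_pos_iff, sub_ne_zero]
      rintro h; exact hx (h ▸ hrB x)
    set c := (1 - ‖r x‖) / ‖x - r x‖ with hc
    have hcpos : 0 < c := div_pos (by linarith) hd
    have hw : r x + c • (x - r x) ∈ closedBall (0:E) 1 := by
      rw [mem_closedBall_zero_iff]
      calc _ ≤ ‖r x‖ + ‖c • (x - r x)‖ := norm_add_le _ _
        _ = ‖r x‖ + c * ‖x - r x‖ := by rw [norm_smul, Real.norm_of_nonneg hcpos.le]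
        _ = 1 := by rw [hc, div_mul_cancel₀ _ hd.ne']; ring
        _ ≤ 1 := le_rfl
    have := hrin x _ hw
    rw [add_sub_cancel_left, inner_smul_right, real_inner_self_eq_norm_sq] at this
    have : 0 < c * ‖x - r x‖ ^ 2 := by positivity
    linarith
  set h : E → E := fun x => x + t • g (r x) with hh
  have hinj : Function.Injective h := by
    intro x y hxy
    have e : x - y = t • (g (r y) - g (r x)) := by
      simp only [hh] at hxy
      rw [smul_sub, sub_eq_sub_iff_add_eq_add, hxy, add_comm]
    have h1 : ‖x - y‖ ≤ t * (L * ‖x - y‖) := by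
      calc ‖x - y‖ = t * ‖g (r y) - g (r x)‖ := by rw [e, norm_smul, Real.norm_of_nonneg ht]
        _ ≤ t * (L * ‖x - y‖) := by
          apply mul_le_mul_of_nonneg_left _ ht
          have := hgL.dist_le_mul y x
          rwa [dist_eq_norm, dist_eq_norm, norm_sub_rev y x] at this
    by_contra hne
    have : 0 < ‖x - y‖ := norm_pos_iff.2 (sub_ne_zero.2 hne)
    nlinarith
  have hsurj : Function.Surjective h := by
    intro y
    have hcon : ContractingWith (t.toNNReal * L) (fun x => y - t • g (r x)) := by
      refine ⟨by rw [← NNReal.coe_lt_coe]; simpa [ht] using htL, ?_⟩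
      apply LipschitzWith.of_dist_le_mul
      intro a b
      have := hgL.dist_le_mul a b
      simp only [Function.comp] at this
      rw [dist_sub_left, dist_smul₀, Real.norm_of_nonneg ht, NNReal.coe_mul, Real.coe_toNNReal t ht, mul_assoc]
      exact mul_le_mul_of_nonneg_left this ht
    have := hcon.fixedPoint_isFixedPt
    refine ⟨hcon.fixedPoint, ?_⟩
    have e : y - t • g (r hcon.fixedPoint) = hcon.fixedPoint := this
    simp only [hh]
    nth_rewrite 1 [← e]
    simp
  have hhout : ∀ x, x ∉ closedBall (0:E) 1 → h x = x := by
    intro x hx; simp [hh, hout x hx]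
  have heq : Set.EqOn h (fun x => x + t • g x) (closedBall 0 1) := by
    intro x hx; simp only [hh]; rw [hrid x hx]
  refine ⟨(hinj.injOn).congr heq, ?_⟩
  rw [← heq.image_eq]
  ext y
  constructor
  · rintro ⟨x, hx, rfl⟩
    by_contra hy
    exact hy ((hinj (hhout _ hy)).symm ▸ hx)
  · intro hy
    obtain ⟨x, rfl⟩ := hsurj y
    refine ⟨x, ?_, rfl⟩
    by_contra hx
    exact hx ((hhout x hx) ▸ hy)


open Metric in
lemma no_smooth_retraction [MeasurableSpace E] [BorelSpace E] {g : E → E} (hg : ∀ x ∈ closedBall (0:E) 1, ContDiffAt ℝ 1 g x)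
    (hg0 : ∀ x, ‖x‖ = 1 → g x = 0)
    (hret : ∀ x ∈ ball (0:E) 1, (ContinuousLinearMap.id ℝ E + fderiv ℝ g x).det = 0) : False := by
  set B := closedBall (0:E) 1 with hB
  have hBc : IsCompact B := isCompact_closedBall _ _
  have hDc : ContinuousOn (fderiv ℝ g) B := fun x hx =>
    ((hg x hx).continuousAt_fderiv (by simp)).continuousWithinAt
  have hDer : ∀ x ∈ B, HasFDerivAt g (fderiv ℝ g x) x := fun x hx =>
    ((hg x hx).differentiableAt (by simp)).hasFDerivAt
  obtain ⟨M, hM⟩ := hBc.exists_bound_of_continuousOn hDc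
  have hM0 : 0 ≤ M := (norm_nonneg _).trans (hM 0 (by simp [hB]))
  have hLip : LipschitzOnWith M.toNNReal g B := by
    apply Convex.lipschitzOnWith_of_nnnorm_hasFDerivWithin_le (𝕜 := ℝ)
      (fun x hx => (hDer x hx).hasFDerivWithinAt) _ (convex_closedBall _ _)
    intro x hx
    rw [← NNReal.coe_le_coe, Real.coe_toNNReal M hM0]
    exact hM x hx
  have hdetInt : ∀ t : ℝ, IntegrableOn (fun x => (ContinuousLinearMap.id ℝ E + t • fderiv ℝ g x).det) B volume := by
    intro t
    apply ContinuousOn.integrableOn_compact hBc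
    exact ContinuousLinearMap.continuous_det.comp_continuousOn
      (continuousOn_const.add (hDc.const_smul t))
  have hsmall : ∀ t : ℝ, 0 ≤ t → t * M < 1 →
      ∫ x in B, (ContinuousLinearMap.id ℝ E + t • fderiv ℝ g x).det = volume.real B := by
    intro t ht htM
    obtain ⟨hi, him⟩ := image_closedBall_of_small hLip hg0 t ht (by rwa [Real.coe_toNNReal M hM0])
    have := integral_image_eq_integral_abs_det_fderiv_smul (μ := (volume : Measure E)) (s := B)
      (f := fun x => x + t • g x) (f' := fun x => ContinuousLinearMap.id ℝ E + t • fderiv ℝ g x)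
      isClosed_closedBall.measurableSet
      (fun x hx => ((hasFDerivAt_id x).add ((hDer x hx).const_smul t)).hasFDerivWithinAt) hi
      (fun _ => (1:ℝ))
    rw [him] at this
    have e1 : ∫ x in B, (1:ℝ) = volume.real B := by simp
    rw [← e1, this]
    apply setIntegral_congr_fun isClosed_closedBall.measurableSet
    intro x hx
    have hp := det_pos_of_small (fderiv ℝ g x) t ht
      (lt_of_le_of_lt (mul_le_mul_of_nonneg_left (hM x hx) ht) htM)
    simp [abs_of_pos hp]
  set d := Module.finrank ℝ E
  set s := Finset.range (d + 1)
  set v : ℕ → ℝ := fun j => (1 / (M + 1)) * (j / (d + 1)) with hv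
  have hvinj : Set.InjOn v s := by
    intro a _ b _ hab
    simp only [hv] at hab
    have h1 : (1 / (M + 1)) ≠ 0 := by positivity
    have h2 := mul_left_cancel₀ h1 hab
    have h3 : (a:ℝ) = b := by
      have : ((d:ℝ) + 1) ≠ 0 := by positivity
      field_simp at h2
      exact h2
    exact_mod_cast h3
  have hv0 : ∀ j ∈ s, 0 ≤ v j := fun j _ => by simp only [hv]; positivity
  have hvM : ∀ j ∈ s, v j * M < 1 := by
    intro j hj
    have hj' : (j:ℝ) / (d+1) ≤ 1 := by
      rw [div_le_one (by positivity)]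
      have := (Finset.mem_range.1 hj).le
      exact_mod_cast this
    calc v j * M = (M / (M + 1)) * ((j:ℝ) / (d+1)) := by simp only [hv]; ring
      _ ≤ (M / (M + 1)) * 1 := mul_le_mul_of_nonneg_left hj' (by positivity)
      _ < 1 := by rw [mul_one, div_lt_one (by positivity)]; linarith
  set lam : ℕ → ℝ := fun j => (Lagrange.basis s v j).eval 1 with hlam
  have hsum : ∑ j ∈ s, lam j = 1 := by
    have := congrArg (Polynomial.eval 1) (Lagrange.sum_basis hvinj ⟨0, by simp [s]⟩)
    simpa [Polynomial.eval_finsetSum] using this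
  have hinterp : ∀ D : E →L[ℝ] E, (ContinuousLinearMap.id ℝ E + D).det
      = ∑ j ∈ s, lam j * (ContinuousLinearMap.id ℝ E + v j • D).det := by
    intro D
    obtain ⟨p, hp, hpe⟩ := exists_poly_det D
    have hdeg : p.degree < s.card := by
      refine lt_of_le_of_lt Polynomial.degree_le_natDegree ?_
      simp only [s, Finset.card_range]
      exact_mod_cast Nat.lt_succ_of_le hp
    have h1 := congrArg (Polynomial.eval 1) (Lagrange.eq_interpolate hvinj hdeg)
    rw [hpe, Lagrange.interpolate_apply, Polynomial.eval_finsetSum, one_smul] at h1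
    rw [h1]
    refine Finset.sum_congr rfl fun j _ => ?_
    simp [hlam, hpe, mul_comm]
  have hz : ∫ x in B, (ContinuousLinearMap.id ℝ E + fderiv ℝ g x).det = 0 := by
    rw [← integral_zero E ℝ (μ := volume.restrict B)]
    have hDc' : ContinuousOn (fun x => (ContinuousLinearMap.id ℝ E + fderiv ℝ g x).det) B :=
      ContinuousLinearMap.continuous_det.comp_continuousOn (continuousOn_const.add hDc)
    by_cases hE : Subsingleton E
    · apply setIntegral_congr_fun isClosed_closedBall.measurableSet
      intro x hx
      have : x = 0 := Subsingleton.elim _ _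
      exact hret x (by simp [this])
    · apply setIntegral_congr_fun isClosed_closedBall.measurableSet
      have hcl : B = closure (ball (0:E) 1) := (closure_ball 0 one_ne_zero).symm
      have : Set.EqOn (fun x => (ContinuousLinearMap.id ℝ E + fderiv ℝ g x).det) (fun _ => (0:ℝ)) B := by
        refine Set.EqOn.of_subset_closure (s := ball (0:E) 1) hret hDc' continuousOn_const ?_ hcl.le
        exact ball_subset_closedBall
      exact this
  have hfin : ∫ x in B, (ContinuousLinearMap.id ℝ E + fderiv ℝ g x).det = volume.real B := by
    rw [funext fun x => hinterp (fderiv ℝ g x)]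
    rw [integral_finsetSum _ (fun j _ => (hdetInt (v j)).const_mul (lam j))]
    simp_rw [integral_const_mul]
    rw [Finset.sum_congr rfl (fun j hj => by rw [hsmall (v j) (hv0 j hj) (hvM j hj)]), ← Finset.sum_mul,
      hsum, one_mul]
  have hpos : 0 < volume.real B := by
    rw [Measure.real, ENNReal.toReal_pos_iff]
    exact ⟨measure_closedBall_pos _ _ one_pos, measure_closedBall_lt_top⟩
  linarith

open Metric in
lemma smooth_brouwer {f : E → E} (hf : ContDiff ℝ 1 f) (hf1 : ∀ x, ‖f x‖ < 1) :
    ∃ x, f x = x := by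
  borelize E
  by_contra! hne
  set u : E → E := fun x => x - f x with hu
  have hus : ContDiff ℝ 1 u := contDiff_id.sub hf
  have hu0 : ∀ x, 0 < ‖u x‖ ^ 2 := fun x => by
    have : u x ≠ 0 := sub_ne_zero.2 (hne x).symm
    positivity
  have hus2 : ContDiff ℝ 1 fun x => ‖u x‖ ^ 2 := hus.norm_sq ℝ
  have hin : ContDiff ℝ 1 fun x => inner ℝ x (u x) := contDiff_id.inner ℝ hus
  set Δ : E → ℝ := fun x => (inner ℝ x (u x)) ^ 2 + ‖u x‖ ^ 2 * (1 - ‖x‖ ^ 2) with hΔ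
  have hΔs : ContDiff ℝ 1 Δ := (hin.pow 2).add (hus2.mul (contDiff_const.sub (contDiff_id.norm_sq ℝ)))
  have hsph : ∀ x, ‖x‖ = 1 → 0 < inner ℝ x (u x) := by
    intro x hx
    simp only [hu, inner_sub_right, real_inner_self_eq_norm_sq, hx]
    have := real_inner_le_norm x (f x)
    have := hf1 x
    rw [hx] at *
    linarith
  have hΔpos : ∀ x ∈ closedBall (0:E) 1, 0 < Δ x := by
    intro x hx
    rw [mem_closedBall_zero_iff] at hx
    rcases hx.lt_or_eq with h | h
    · have h1 : 0 < 1 - ‖x‖ ^ 2 := by nlinarith [norm_nonneg x]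
      have := mul_pos (hu0 x) h1
      simp only [hΔ]; positivity
    · have := hsph x h
      simp only [hΔ, h]; simp; positivity
  set lam : E → ℝ := fun x => (-(inner ℝ x (u x)) + √(Δ x)) / ‖u x‖ ^ 2 with hlam
  set g : E → E := fun x => lam x • u x with hg
  have hgs : ∀ x ∈ closedBall (0:E) 1, ContDiffAt ℝ 1 g x := by
    intro x hx
    have h1 : ContDiffAt ℝ 1 (fun x => √(Δ x)) x := hΔs.contDiffAt.sqrt (hΔpos x hx).ne'
    exact ((hin.neg.contDiffAt.add h1).div hus2.contDiffAt (hu0 x).ne').smul hus.contDiffAt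
  have hnorm : ∀ x ∈ closedBall (0:E) 1, ‖x + g x‖ ^ 2 = 1 := by
    intro x hx
    have hs := Real.sq_sqrt (hΔpos x hx).le
    rw [norm_add_sq_real]
    simp only [hg, inner_smul_right, norm_smul, mul_pow, Real.norm_eq_abs, sq_abs]
    have hl : lam x * ‖u x‖ ^ 2 = -(inner ℝ x (u x)) + √(Δ x) := div_mul_cancel₀ _ (hu0 x).ne'
    have h3 : (lam x * ‖u x‖ ^ 2 + inner ℝ x (u x)) ^ 2 = Δ x := by rw [hl, neg_add_cancel_comm]; exact hs
    have h4 : ‖u x‖ ^ 2 * (‖x‖ ^ 2 + 2 * (lam x * inner ℝ x (u x)) + lam x ^ 2 * ‖u x‖ ^ 2 - 1) = 0 := by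
      simp only [hΔ] at h3
      linear_combination h3
    rcases mul_eq_zero.1 h4 with h | h
    · exact absurd h (hu0 x).ne'
    · linarith
  refine no_smooth_retraction hgs ?_ ?_
  · intro x hx
    have : Δ x = (inner ℝ x (u x)) ^ 2 := by simp [hΔ, hx]
    simp only [hg, hlam]
    rw [this, Real.sqrt_sq (hsph x hx).le]
    simp
  · intro x hx
    by_contra hdet
    have hxB := ball_subset_closedBall hx
    have hD : HasFDerivAt (fun y => y + g y) (ContinuousLinearMap.id ℝ E + fderiv ℝ g x) x :=
      (hasFDerivAt_id x).add ((hgs x hxB).differentiableAt (by simp)).hasFDerivAt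
    set D := ContinuousLinearMap.id ℝ E + fderiv ℝ g x
    have h2 : HasFDerivAt (fun y => ‖y + g y‖ ^ 2) (2 • (innerSL ℝ (x + g x)).comp D) x := hD.norm_sq
    have h3 : (fun y => ‖y + g y‖ ^ 2) =ᶠ[nhds x] fun _ => (1:ℝ) := by
      filter_upwards [isOpen_ball.mem_nhds hx] with y hy
      exact hnorm y (ball_subset_closedBall hy)
    have h4 : HasFDerivAt (fun y => ‖y + g y‖ ^ 2) (0 : E →L[ℝ] ℝ) x :=
      (hasFDerivAt_const (1:ℝ) x).congr_of_eventuallyEq h3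
    have h5 := h2.unique h4
    have hsurj : Function.Surjective D := by
      have hU : IsUnit (LinearMap.det (D : E →ₗ[ℝ] E)) := isUnit_iff_ne_zero.2 hdet
      exact (LinearEquiv.ofIsUnitDet (v := Module.finBasis ℝ E) (v' := Module.finBasis ℝ E) (f := (D : E →ₗ[ℝ] E)) (by rwa [LinearMap.det_toMatrix])).surjective
    obtain ⟨w, hw⟩ := hsurj (x + g x)
    have h6 : (2 • (innerSL ℝ (x + g x)).comp D) w = 0 := by rw [h5]; rfl
    have h7 : (2:ℝ) * inner ℝ (x + g x) (x + g x) = 0 := by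
      rw [← h6]; simp [-map_add, hw]
    rw [real_inner_self_eq_norm_sq, hnorm x hxB] at h7
    norm_num at h7

open Metric in
/-- Brouwer for maps into the unit ball. -/
lemma brouwer_unit {f : E → E} (hf : Continuous f) (hf1 : ∀ x, ‖f x‖ ≤ 1) : ∃ x, f x = x := by
  by_contra! hne
  have hBc : IsCompact (closedBall (0:E) 1) := isCompact_closedBall _ _
  obtain ⟨x0, hx0, hmin⟩ := hBc.exists_isMinOn ⟨0, by simp⟩
    (f := fun x => ‖f x - x‖) (by fun_prop)
  set c := ‖f x0 - x0‖
  have hc : 0 < c := norm_pos_iff.2 (sub_ne_zero.2 (hne x0))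
  set η := min (c / 4) 1
  have hη : 0 < η := by positivity
  obtain ⟨g, hg, hgf, -⟩ := Continuous.exists_contDiff_approx (ε := fun _ => η) 1 hf continuous_const
    (fun _ => hη)
  have hgn : ∀ x, ‖g x‖ < 1 + η := fun x => by
    have := hgf x
    rw [dist_eq_norm] at this
    calc ‖g x‖ = ‖(g x - f x) + f x‖ := by rw [sub_add_cancel]
      _ ≤ ‖g x - f x‖ + ‖f x‖ := norm_add_le _ _
      _ < _ := by linarith [hf1 x]
  obtain ⟨x, hx⟩ := smooth_brouwer (f := fun x => (1 + η)⁻¹ • g x) (contDiff_const.smul hg) (by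
    intro x
    rw [norm_smul, Real.norm_of_nonneg (by positivity), inv_mul_lt_iff₀ (by positivity)]
    linarith [hgn x])
  have hgx : g x = (1 + η) • x := by
    conv_rhs => rw [← hx]
    rw [smul_smul, mul_inv_cancel₀ (by positivity), one_smul]
  have hxn : ‖x‖ ≤ 1 := by
    have := hgn x
    rw [hgx, norm_smul, Real.norm_of_nonneg (by positivity)] at this
    by_contra! h
    nlinarith
  have h1 : c ≤ ‖f x - x‖ := hmin (by simpa using hxn)
  have h2 : ‖f x - x‖ ≤ ‖f x - g x‖ + ‖g x - x‖ := norm_sub_le_norm_sub_add_norm_sub _ _ _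
  have h3 : ‖g x - x‖ ≤ η := by
    rw [hgx, add_smul, one_smul, add_sub_cancel_left, norm_smul, Real.norm_of_nonneg hη.le]
    nlinarith
  have h4 := hgf x
  rw [dist_comm, dist_eq_norm] at h4
  have : η ≤ c / 4 := min_le_left _ _
  linarith

/-- Hartman–Stampacchia variational inequality. -/
lemma exists_variational {K : Set E} (hne : K.Nonempty) (hc : IsCompact K) (hK : Convex ℝ K)
    {v : E → E} (hv : ContinuousOn v K) :
    ∃ x ∈ K, ∀ y ∈ K, inner ℝ (v x) (y - x) ≤ 0 := by
  obtain ⟨r, hrl, hrK, hrid, hrin⟩ := exists_convex_proj hne hc.isClosed hK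
  obtain ⟨M, hM⟩ := hc.isBounded.exists_norm_le
  set C := max M 1
  have hC : 0 < C := by positivity
  have hvr : Continuous fun x => v (r x) := hv.comp_continuous hrl.continuous hrK
  obtain ⟨z, hz⟩ := brouwer_unit (f := fun z => C⁻¹ • r (r (C • z) + v (r (C • z)))) (by
      have h1 : Continuous fun z : E => C • z := by fun_prop
      exact (hrl.continuous.comp ((hrl.continuous.comp h1).add (hvr.comp h1))).const_smul _) (by
    intro z
    rw [norm_smul, Real.norm_of_nonneg (by positivity), inv_mul_le_iff₀ hC, mul_one]
    exact (hM _ (hrK _)).trans (le_max_left _ _))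
  set x := C • z
  have hx : r (r x + v (r x)) = x := by
    simp only [x]
    conv_rhs => rw [← hz]
    rw [smul_smul, mul_inv_cancel₀ hC.ne', one_smul]
  have hxK : x ∈ K := hx ▸ hrK _
  rw [hrid x hxK] at hx
  refine ⟨x, hxK, fun y hy => ?_⟩
  have := hrin (x + v x) y hy
  rwa [hx, add_sub_cancel_left] at this

end Brouwer


section Types

lemma quantize_step {Ω : Type*} {F₀ : MeasurableSpace Ω} (P : Measure Ω) [IsProbabilityMeasure P]
    (m : MeasurableSpace Ω) (hm : m ≤ F₀) (Z : Ω → ℕ) (hZ : Measurable[F₀] Z) (S : Finset ℕ)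
    (hS : ∀ ω, Z ω ∈ S) (δ : ℝ) (hδ : 0 < δ) :
    ∃ (q : Ω → ℕ) (Q : ℕ → ℕ → ℝ) (S' : Finset ℕ), Measurable[m] q ∧ (∀ ω, q ω ∈ S') ∧
      ∀ f : Ω → ℕ → ℝ, (∀ z, Measurable[m] (fun ω => f ω z)) → (∀ ω z, |f ω z| ≤ 1) →
        |∫ ω, f ω (Z ω) ∂P - ∫ ω, ∑ z ∈ S, f ω z * Q (q ω) z ∂P| ≤ δ := by
  classical
  obtain ⟨N, hN⟩ := exists_nat_gt ((S.card : ℝ) / δ)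
  have hN0 : 0 < (N : ℝ) := lt_of_le_of_lt (by positivity) hN
  let I : ℕ → Ω → ℝ := fun z => (Z ⁻¹' {z}).indicator (fun _ => (1:ℝ))
  have hIm : ∀ z, MeasurableSet[F₀] (Z ⁻¹' {z}) := fun z => hZ (measurableSet_singleton z)
  have hIint : ∀ z, Integrable (I z) P := fun z => (integrable_const (1:ℝ)).indicator (hIm z)
  let G : ℕ → Ω → ℝ := fun z => P[I z | m]
  have hGm : ∀ z, Measurable[m] (G z) := fun z => stronglyMeasurable_condExp.measurable
  have hG01 : ∀ z, ∀ᵐ ω ∂P, 0 ≤ G z ω ∧ G z ω ≤ 1 := by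
    intro z
    have h0 : 0 ≤ᵐ[P] P[I z | m] := condExp_nonneg (Filter.Eventually.of_forall fun ω =>
      Set.indicator_nonneg (fun _ _ => zero_le_one) ω)
    have h1 : P[I z | m] ≤ᵐ[P] P[fun _ => (1:ℝ) | m] := condExp_mono (hIint z) (integrable_const 1)
      (Filter.Eventually.of_forall fun ω => Set.indicator_le_self' (fun _ _ => zero_le_one) ω)
    rw [condExp_const hm] at h1
    filter_upwards [h0, h1] with ω h0 h1 using ⟨h0, h1⟩
  let fl : ℕ → Ω → ℕ := fun z ω => min ⌊(N:ℝ) * G z ω⌋₊ N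
  have hflm : ∀ z, Measurable[m] (fl z) := fun z =>
    (Nat.measurable_floor.comp ((hGm z).const_mul (N:ℝ))).min measurable_const
  let qh : Ω → (S → Fin (N+1)) := fun ω z => ⟨fl z ω, Nat.lt_succ_of_le (min_le_right _ _)⟩
  have hqh : Measurable[m] qh := by
    refine @measurable_pi_lambda _ _ _ m _ _ fun z => ?_
    refine @measurable_to_countable' _ _ _ _ m _ fun j => ?_
    have : (fun ω => qh ω z) ⁻¹' {j} = fl z ⁻¹' {(j:ℕ)} := by
      ext ω; simp [qh, Fin.ext_iff]
    rw [this]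
    exact hflm z (measurableSet_singleton _)
  let e := Fintype.equivFin (S → Fin (N+1))
  let q : Ω → ℕ := fun ω => e (qh ω)
  let Q : ℕ → ℕ → ℝ := fun a z =>
    if h : a < Fintype.card (S → Fin (N+1)) ∧ z ∈ S then
      (((e.symm ⟨a, h.1⟩) ⟨z, h.2⟩ : Fin (N+1)) : ℕ) / (N:ℝ) else 0
  have hqm : Measurable[m] q := by
    have : Measurable fun a : S → Fin (N+1) => ((e a : Fin _) : ℕ) := measurable_of_countable _
    exact this.comp hqh
  have hQ : ∀ ω, ∀ z ∈ S, Q (q ω) z = (fl z ω : ℝ) / N := by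
    intro ω z hz
    simp only [Q, q]
    rw [dif_pos ⟨(e (qh ω)).2, hz⟩]
    simp [qh]
  have hQm : ∀ z, Measurable[m] fun ω => Q (q ω) z := fun z =>
    (measurable_of_countable fun a => Q a z).comp hqm
  have hclose : ∀ z ∈ S, ∀ᵐ ω ∂P, |G z ω - Q (q ω) z| ≤ 1 / N := by
    intro z hz
    filter_upwards [hG01 z] with ω hω
    rw [hQ ω z hz]
    have h1 : ⌊(N:ℝ) * G z ω⌋₊ ≤ N := by
      apply Nat.floor_le_of_le
      nlinarith [hω.2]
    simp only [fl, min_eq_left h1]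
    have h2 := Nat.floor_le (a := (N:ℝ) * G z ω) (mul_nonneg hN0.le hω.1)
    have h3 := Nat.lt_floor_add_one ((N:ℝ) * G z ω)
    rw [abs_le]
    constructor
    · rw [neg_le_sub_iff_le_add, div_le_iff₀ hN0, add_mul, one_div, inv_mul_cancel₀ hN0.ne']
      linarith
    · rw [sub_le_iff_le_add, ← add_div, le_div_iff₀ hN0]
      linarith
  refine ⟨q, Q, Finset.range (Fintype.card (S → Fin (N+1))), hqm,
    fun ω => Finset.mem_range.2 (e (qh ω)).2, ?_⟩
  intro f hfm hf1
  have hfint : ∀ z, Integrable (fun ω => f ω z) P := fun z =>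
    Integrable.of_bound ((hfm z).mono hm le_rfl).aestronglyMeasurable 1
      (Filter.Eventually.of_forall fun ω => hf1 ω z)
  have hfI : ∀ z, Integrable ((fun ω => f ω z) * I z) P := fun z =>
    (hIint z).bdd_mul (c := 1) ((hfm z).mono hm le_rfl).aestronglyMeasurable
      (Filter.Eventually.of_forall fun ω => hf1 ω z)
  have hfG : ∀ z, Integrable (fun ω => f ω z * G z ω) P := fun z =>
    (integrable_condExp (m := m) (μ := P) (f := I z)).bdd_mul (c := 1)
      ((hfm z).mono hm le_rfl).aestronglyMeasurable
      (Filter.Eventually.of_forall fun ω => hf1 ω z)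
  have hfQ : ∀ z ∈ S, Integrable (fun ω => f ω z * Q (q ω) z) P := by
    intro z hz
    refine Integrable.of_bound (((hfm z).mul (hQm z)).mono hm le_rfl).aestronglyMeasurable 1
      (Filter.Eventually.of_forall fun ω => ?_)
    rw [norm_mul]
    have h1 : ‖Q (q ω) z‖ ≤ 1 := by
      rw [hQ ω z hz, Real.norm_of_nonneg (by positivity), div_le_one hN0]
      exact_mod_cast min_le_right _ _
    exact mul_le_one₀ (hf1 ω z) (norm_nonneg _) h1
  have e1 : ∀ ω, f ω (Z ω) = ∑ z ∈ S, f ω z * I z ω := by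
    intro ω
    rw [Finset.sum_eq_single (Z ω)]
    · simp [I]
    · intro z _ hz
      have : ω ∉ Z ⁻¹' {z} := fun h => hz (Set.mem_singleton_iff.1 h).symm
      simp [I, Set.indicator_of_notMem this]
    · intro h; exact absurd (hS ω) h
  have e2 : ∀ z, ∫ ω, f ω z * I z ω ∂P = ∫ ω, f ω z * G z ω ∂P := by
    intro z
    have := condExp_mul_of_stronglyMeasurable_left (μ := P) (hfm z).stronglyMeasurable (hfI z) (hIint z)
    calc ∫ ω, f ω z * I z ω ∂P = ∫ ω, (P[(fun ω => f ω z) * I z | m]) ω ∂P := (integral_condExp hm).symm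
      _ = _ := integral_congr_ae this
  rw [integral_congr_ae (Filter.Eventually.of_forall e1), integral_finsetSum (f := fun z ω => f ω z * I z ω) _ (fun z _ => hfI z),
    integral_finsetSum _ hfQ, Finset.sum_congr rfl (fun z _ => e2 z), ← Finset.sum_sub_distrib]
  calc _ ≤ ∑ z ∈ S, |∫ ω, f ω z * G z ω ∂P - ∫ ω, f ω z * Q (q ω) z ∂P| := Finset.abs_sum_le_sum_abs _ _
    _ ≤ ∑ z ∈ S, 1 / (N:ℝ) := by
      refine Finset.sum_le_sum fun z hz => ?_
      rw [← integral_sub (hfG z) (hfQ z hz), ← Real.norm_eq_abs]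
      refine (norm_integral_le_of_norm_le_const (C := 1 / N) ?_).trans (by simp)
      filter_upwards [hclose z hz] with ω hω
      rw [← mul_sub, norm_mul]
      calc _ ≤ 1 * (1 / (N:ℝ)) := mul_le_mul (hf1 ω z) hω (abs_nonneg _) zero_le_one
        _ = _ := one_mul _
    _ = S.card / N := by simp [div_eq_mul_inv]
    _ ≤ δ := by
      rw [div_le_iff₀ hN0]
      rw [div_lt_iff₀ hδ] at hN
      linarith


lemma exists_types {Ω : Type*} {F₀ : MeasurableSpace Ω} (P : Measure Ω) [IsProbabilityMeasure P]
    {n : ℕ} (F : Fin n → MeasurableSpace Ω) (hFsub : ∀ i, F i ≤ F₀)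
    (hnested : ∀ i j : Fin n, i ≤ j → F j ≤ F i)
    (k : Ω → ℕ) (hk : Measurable[F₀] k) (S : Finset ℕ) (hS : ∀ ω, k ω ∈ S)
    (δ : ℝ) (hδ : 0 < δ) :
    ∃ (M : ℕ) (t : Fin n → Ω → (Fin n → Fin (M+1))), (∀ i, Measurable[F i] (t i)) ∧
      ∀ (i : Fin n) (H : Ω → ℝ),
        (∀ ω ω', k ω = k ω' → (∀ j, t j ω = t j ω') → H ω = H ω') → (∀ ω, |H ω| ≤ 1) →
        ∃ V : (Fin n → Fin (M+1)) → ℝ, ∀ y : Ω → ℝ, Measurable[F i] y → (∀ ω, |y ω| ≤ 1) →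
          |∫ ω, y ω * H ω ∂P - ∫ ω, y ω * V (t i ω) ∂P| ≤ δ := by
  classical
  let F' : ℕ → MeasurableSpace Ω := fun i => if h : i < n then F ⟨i, h⟩ else F₀
  have hF' : ∀ i, F' i ≤ F₀ := by
    intro i
    simp only [F']
    split_ifs with h
    · exact hFsub _
    · exact le_rfl
  have hF'i : ∀ i : Fin n, F' i = F i := fun i => by simp [F']
  let St := {Z : (Ω → ℕ) × Finset ℕ // Measurable[F₀] Z.1 ∧ ∀ ω, Z.1 ω ∈ Z.2}
  have hstep := fun (i : ℕ) (Z : St) =>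
    quantize_step P (F' i) (hF' i) Z.1.1 Z.2.1 Z.1.2 Z.2.2 δ hδ
  choose qf Qf Sf hqm hqS hqf using hstep
  have hpm : ∀ (i : ℕ) (Z : St), Measurable[F₀] fun ω => Nat.pair (Z.1.1 ω) (qf i Z ω) := by
    intro i Z
    have h1 : Measurable[F₀] (qf i Z) := (hqm i Z).mono (hF' i) le_rfl
    have h2 : Measurable[F₀] Z.1.1 := Z.2.1
    exact (measurable_of_countable (fun p : ℕ × ℕ => Nat.pair p.1 p.2)).comp (h2.prodMk h1)
  let next : ℕ → St → St := fun i Z =>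
    ⟨(fun ω => Nat.pair (Z.1.1 ω) (qf i Z ω), (Z.1.2 ×ˢ Sf i Z).image fun p => Nat.pair p.1 p.2),
      hpm i Z,
      fun ω => Finset.mem_image.2 ⟨(_, _), Finset.mem_product.2 ⟨Z.2.2 ω, hqS i Z ω⟩, rfl⟩⟩
  let Zs : ℕ → St := fun i => Nat.rec ⟨(k, S), hk, hS⟩ (fun i Z => next i Z) i
  have hZ0 : ∀ ω, (Zs 0).1.1 ω = k ω := fun ω => rfl
  have hZs : ∀ i ω, (Zs (i+1)).1.1 ω = Nat.pair ((Zs i).1.1 ω) (qf i (Zs i) ω) := fun i ω => rfl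
  have hdet : ∀ i ω ω', (Zs i).1.1 ω = (Zs i).1.1 ω' →
      k ω = k ω' ∧ ∀ j < i, qf j (Zs j) ω = qf j (Zs j) ω' := by
    intro i
    induction i with
    | zero => intro ω ω' h; exact ⟨by rwa [hZ0, hZ0] at h, by simp⟩
    | succ i ih =>
      intro ω ω' h
      rw [hZs, hZs, Nat.pair_eq_pair] at h
      obtain ⟨h1, h2⟩ := ih ω ω' h.1
      refine ⟨h1, fun j hj => ?_⟩
      rcases Nat.lt_succ_iff_lt_or_eq.1 hj with h3 | h3
      · exact h2 j h3
      · subst h3; exact h.2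
  let q : Fin n → Ω → ℕ := fun i => qf i (Zs i)
  obtain ⟨M, hM⟩ : ∃ M : ℕ, ∀ i ω, q i ω ≤ M := by
    refine ⟨(Finset.univ.biUnion fun i : Fin n => Sf i (Zs i)).sup id, fun i ω => ?_⟩
    exact Finset.le_sup (f := id) (Finset.mem_biUnion.2 ⟨i, Finset.mem_univ _, hqS i (Zs i) ω⟩)
  let t : Fin n → Ω → (Fin n → Fin (M+1)) := fun i ω j =>
    if i ≤ j then ⟨q j ω, Nat.lt_succ_of_le (hM j ω)⟩ else 0
  have hqF : ∀ i, Measurable[F i] (q i) := fun i => by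
    have := hqm i (Zs i); rwa [hF'i] at this
  have htm : ∀ i, Measurable[F i] (t i) := by
    intro i
    refine @measurable_pi_lambda _ _ _ (F i) _ _ fun j => ?_
    by_cases hij : i ≤ j
    · simp only [t, hij, if_true]
      refine @measurable_to_countable' _ _ _ _ (F i) _ fun a => ?_
      have : (fun ω => (⟨q j ω, Nat.lt_succ_of_le (hM j ω)⟩ : Fin (M+1))) ⁻¹' {a} = q j ⁻¹' {(a:ℕ)} := by
        ext ω; simp [Fin.ext_iff]
      rw [this]
      exact hnested i j hij _ (hqF j (measurableSet_singleton _))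
    · simp only [t, hij, if_false]
      exact @measurable_const _ _ _ (F i) _
  have htself : ∀ i ω, ((t i ω i : Fin (M+1)) : ℕ) = q i ω := by
    intro i ω; simp [t]
  refine ⟨M, t, htm, ?_⟩
  intro i H hH hH1
  have hHfac : ∀ ω ω', (Zs i).1.1 ω = (Zs i).1.1 ω' → t i ω = t i ω' → H ω = H ω' := by
    intro ω ω' h1 h2
    obtain ⟨h3, h4⟩ := hdet i ω ω' h1
    have h5 : ∀ j, q j ω = q j ω' := by
      intro j
      by_cases hij : i ≤ j
      · have := congrFun h2 j
        simpa [t, hij] using this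
      · exact h4 j (by simpa using hij)
    refine hH ω ω' h3 fun j => ?_
    funext l
    simp only [t, h5]
  let w : ℕ → (Fin n → Fin (M+1)) → ℝ := fun z τ =>
    if h : ∃ ω, (Zs i).1.1 ω = z ∧ t i ω = τ then H h.choose else 0
  have hw : ∀ ω, w ((Zs i).1.1 ω) (t i ω) = H ω := by
    intro ω
    have h : ∃ ω', (Zs i).1.1 ω' = (Zs i).1.1 ω ∧ t i ω' = t i ω := ⟨ω, rfl, rfl⟩
    simp only [w]
    rw [dif_pos h]
    exact hHfac _ _ h.choose_spec.1 h.choose_spec.2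
  have hw1 : ∀ z τ, |w z τ| ≤ 1 := by
    intro z τ
    simp only [w]
    split_ifs
    · exact hH1 _
    · simp
  refine ⟨fun τ => ∑ z ∈ (Zs i).1.2, w z τ * Qf i (Zs i) (τ i) z, fun y hy hy1 => ?_⟩
  have := hqf i (Zs i) (fun ω z => y ω * w z (t i ω)) (by
    intro z
    rw [hF'i]
    exact hy.mul ((measurable_of_countable (w z)).comp (htm i))) (by
    intro ω z
    rw [abs_mul]
    exact mul_le_one₀ (hy1 ω) (abs_nonneg _) (hw1 _ _))
  simp only [hw] at this
  convert this using 6 with ω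
  rw [Finset.mul_sum]
  refine Finset.sum_congr rfl fun z _ => ?_
  rw [htself, mul_assoc]

end Types


section Core

/-- Multilinear extension of a finite payoff function. -/
noncomputable def mixedU {n : ℕ} {B : Type*} [Fintype B] (u : (Fin n → B) → ℝ)
    (p : Fin n → B → ℝ) : ℝ := ∑ b, u b * ∏ j, p j (b j)

lemma mixedU_update {n : ℕ} {B : Type*} [Fintype B] [DecidableEq B] (u : (Fin n → B) → ℝ)
    (p : Fin n → B → ℝ) (i : Fin n) (y : B → ℝ) :
    mixedU u (Function.update p i y)
      = ∑ c, y c * mixedU u (Function.update p i (Pi.single c 1)) := by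
  have h : ∀ (y : B → ℝ) (b : Fin n → B), ∏ j, Function.update p i y j (b j)
      = y (b i) * ∏ j ∈ Finset.univ.erase i, p j (b j) := by
    intro y b
    rw [← Finset.mul_prod_erase Finset.univ _ (Finset.mem_univ i), Function.update_self]
    congr 1
    refine Finset.prod_congr rfl fun j hj => ?_
    rw [Function.update_of_ne (Finset.ne_of_mem_erase hj)]
  simp only [mixedU, h, Finset.mul_sum]
  rw [Finset.sum_comm]
  refine Finset.sum_congr rfl fun b _ => ?_
  rw [Finset.sum_eq_single (b i)]
  · simp; ring
  · intro c _ hc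
    simp [Pi.single_apply, hc.symm]
  · simp

lemma abs_mixedU_le {n : ℕ} {B : Type*} [Fintype B] (u : (Fin n → B) → ℝ)
    (p : Fin n → B → ℝ) (C : ℝ) (hu : ∀ b, |u b| ≤ C) (hp : ∀ j, p j ∈ stdSimplex ℝ B) :
    |mixedU u p| ≤ C := by
  classical
  have hprod : ∑ b : Fin n → B, ∏ j, p j (b j) = 1 := by
    have := Finset.prod_univ_sum (fun _ : Fin n => (Finset.univ : Finset B)) (fun j c => p j c)
    rw [Fintype.piFinset_univ] at this
    rw [← this]
    exact Finset.prod_eq_one fun j _ => (hp j).2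
  calc |mixedU u p| ≤ ∑ b : Fin n → B, |u b * ∏ j, p j (b j)| := Finset.abs_sum_le_sum_abs _ _
    _ ≤ ∑ b : Fin n → B, C * ∏ j, p j (b j) := by
      refine Finset.sum_le_sum fun b _ => ?_
      have h0 : 0 ≤ ∏ j, p j (b j) := Finset.prod_nonneg fun j _ => (hp j).1 _
      rw [abs_mul, abs_of_nonneg h0]
      exact mul_le_mul_of_nonneg_right (hu b) h0
    _ = C := by rw [← Finset.mul_sum, hprod, mul_one]

lemma simplexProd_compact {ι B : Type*} [Fintype ι] [Fintype B] :
    IsCompact {X : EuclideanSpace ℝ (ι × B) | ∀ a, (fun c => X (a, c)) ∈ stdSimplex ℝ B} := by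
  refine Metric.isCompact_of_isClosed_isBounded ?_ ?_
  · have : {X : EuclideanSpace ℝ (ι × B) | ∀ a, (fun c => X (a, c)) ∈ stdSimplex ℝ B}
      = ⋂ a, (fun X : EuclideanSpace ℝ (ι × B) => fun c => X (a, c)) ⁻¹' stdSimplex ℝ B := by
      ext; simp
    rw [this]
    exact isClosed_iInter fun a => (isClosed_stdSimplex ℝ B).preimage (by fun_prop)
  · rw [isBounded_iff_forall_norm_le]
    refine ⟨√(Fintype.card (ι × B)), fun X hX => ?_⟩
    rw [EuclideanSpace.norm_eq]
    apply Real.sqrt_le_sqrt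
    calc ∑ i, ‖X i‖ ^ 2 ≤ ∑ i : ι × B, (1:ℝ) := by
          refine Finset.sum_le_sum fun i _ => ?_
          have h0 := (hX i.1).1 i.2
          have h1 : X i ≤ 1 := (hX i.1).2 ▸
            Finset.single_le_sum (f := fun c => X (i.1, c)) (fun c _ => (hX i.1).1 c) (Finset.mem_univ i.2)
          have h0' : 0 ≤ X i := h0
          rw [Real.norm_of_nonneg h0']
          nlinarith
      _ = _ := by simp

lemma simplexProd_convex {ι B : Type*} [Fintype ι] [Fintype B] :
    Convex ℝ {X : EuclideanSpace ℝ (ι × B) | ∀ a, (fun c => X (a, c)) ∈ stdSimplex ℝ B} := by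
  intro X hX Y hY a b ha hb hab i
  have := convex_stdSimplex ℝ B (hX i) (hY i) ha hb hab
  exact this

lemma core {Ω : Type*} {F₀ : MeasurableSpace Ω} (P : Measure Ω) [IsProbabilityMeasure P]
    {n : ℕ} (F : Fin n → MeasurableSpace Ω) (hFsub : ∀ i, F i ≤ F₀)
    (hnested : ∀ i j : Fin n, i ≤ j → F j ≤ F i)
    {B : Type*} [Fintype B] [Nonempty B]
    (k : Ω → ℕ) (hk : Measurable[F₀] k) (S : Finset ℕ) (hS : ∀ ω, k ω ∈ S)
    (u : Fin n → ℕ → (Fin n → B) → ℝ) (C : ℝ) (hC : 0 < C)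
    (hu : ∀ i ω b, |u i (k ω) b| ≤ C) (ε : ℝ) (hε : 0 < ε) :
    ∃ x : Fin n → Ω → B → ℝ, (∀ j c, Measurable[F j] fun ω => x j ω c) ∧
      (∀ j ω, x j ω ∈ stdSimplex ℝ B) ∧
      ∀ i (y : Ω → B → ℝ), (∀ c, Measurable[F i] fun ω => y ω c) →
        (∀ ω, y ω ∈ stdSimplex ℝ B) →
        ∫ ω, mixedU (u i (k ω)) (Function.update (fun j => x j ω) i (y ω)) ∂P
          ≤ ∫ ω, mixedU (u i (k ω)) (fun j => x j ω) ∂P + ε := by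
  classical
  have hcB : 0 < (Fintype.card B : ℝ) := by exact_mod_cast Fintype.card_pos
  set δ : ℝ := ε / (2 * Fintype.card B * C) with hδdef
  have hδ : 0 < δ := by positivity
  obtain ⟨M, t, htm, ht⟩ := exists_types P F hFsub hnested k hk S hS δ hδ
  have htm0 : ∀ i, Measurable[F₀] (t i) := fun i => (htm i).mono (hFsub i) le_rfl
  let Θ : Ω → ℕ × (Fin n → (Fin n → Fin (M+1))) := fun ω => (k ω, fun j => t j ω)
  have hΘ : Measurable[F₀] Θ := hk.prodMk (measurable_pi_lambda _ fun j => htm0 j)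
  let K : Set (EuclideanSpace ℝ ((Fin n × (Fin n → Fin (M+1))) × B)) := {X | ∀ a, (fun c => X (a, c)) ∈ stdSimplex ℝ B}
  let prof : EuclideanSpace ℝ ((Fin n × (Fin n → Fin (M+1))) × B) → (Fin n → (Fin n → Fin (M+1))) → Fin n → B → ℝ := fun X θ j c => X ((j, θ j), c)
  let W : Fin n → B → EuclideanSpace ℝ ((Fin n × (Fin n → Fin (M+1))) × B) → ℕ × (Fin n → (Fin n → Fin (M+1))) → ℝ := fun i c X θ =>
    mixedU (u i θ.1) (Function.update (prof X θ.2) i (Pi.single c 1))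
  have hsing : ∀ c : B, (Pi.single c (1:ℝ) : B → ℝ) ∈ stdSimplex ℝ B := fun c =>
    single_mem_stdSimplex ℝ c
  have hprofK : ∀ X ∈ K, ∀ θ j, prof X θ j ∈ stdSimplex ℝ B := fun X hX θ j => hX (j, θ j)
  have hupd : ∀ X ∈ K, ∀ θ i (z : B → ℝ), z ∈ stdSimplex ℝ B → ∀ j, Function.update (prof X θ) i z j ∈ stdSimplex ℝ B := by
    intro X hX θ i z hz j
    rcases eq_or_ne j i with rfl | h
    · rwa [Function.update_self]
    · rw [Function.update_of_ne h]; exact hprofK X hX θ j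
  have hWb : ∀ i c, ∀ X ∈ K, ∀ ω, |W i c X (Θ ω)| ≤ C := fun i c X hX ω =>
    abs_mixedU_le _ _ C (hu i ω) (hupd X hX _ i _ (hsing c))
  have hWm : ∀ i c X, Measurable[F₀] fun ω => W i c X (Θ ω) := fun i c X =>
    (measurable_of_countable (W i c X)).comp hΘ
  have hWc : ∀ i c θ, Continuous fun X => W i c X θ := by
    intro i c θ
    simp only [W, mixedU]
    refine continuous_finsetSum _ fun b _ => continuous_const.mul (continuous_finsetProd _ fun j _ => ?_)
    rcases eq_or_ne j i with rfl | h
    · simp only [Function.update_self]; exact continuous_const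
    · simp only [Function.update_of_ne h, prof]; fun_prop
  let ind : Fin n → (Fin n → Fin (M+1)) → Ω → ℝ := fun i τ ω => if t i ω = τ then 1 else 0
  have hindm : ∀ i τ, Measurable[F₀] (ind i τ) := fun i τ =>
    (measurable_of_countable fun s : (Fin n → Fin (M+1)) => if s = τ then (1:ℝ) else 0).comp (htm0 i)
  have hind1 : ∀ i τ ω, |ind i τ ω| ≤ 1 := by
    intro i τ ω; simp only [ind]; split_ifs <;> simp
  let v : EuclideanSpace ℝ ((Fin n × (Fin n → Fin (M+1))) × B) → EuclideanSpace ℝ ((Fin n × (Fin n → Fin (M+1))) × B) := fun X => WithLp.toLp 2 fun a => ∫ ω, ind a.1.1 a.1.2 ω * W a.1.1 a.2 X (Θ ω) ∂P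
  have hindWb : ∀ i τ c, ∀ X ∈ K, ∀ ω, ‖ind i τ ω * W i c X (Θ ω)‖ ≤ C := by
    intro i τ c X hX ω
    rw [norm_mul]
    calc _ ≤ 1 * C := mul_le_mul (hind1 _ _ _) (hWb _ _ X hX ω) (abs_nonneg _) zero_le_one
      _ = C := one_mul C
  have hvc : ContinuousOn v K := by
    refine (PiLp.continuous_toLp 2 _).comp_continuousOn (continuousOn_pi.2 fun a => ?_)
    refine continuousOn_of_dominated (bound := fun _ => C) ?_ ?_ (integrable_const C) ?_
    · intro X hX
      exact ((hindm _ _).mul (hWm _ _ X)).aestronglyMeasurable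
    · intro X hX
      exact Filter.Eventually.of_forall fun ω => hindWb _ _ _ X hX ω
    · exact Filter.Eventually.of_forall fun ω => (continuous_const.mul (hWc _ _ _)).continuousOn
  have hKne : K.Nonempty := ⟨WithLp.toLp 2 fun a => (Pi.single (Classical.arbitrary B) (1:ℝ) : B → ℝ) a.2,
    fun a => hsing _⟩
  obtain ⟨X, hX, hVI⟩ := exists_variational hKne simplexProd_compact simplexProd_convex hvc
  have hindWint : ∀ i τ c, Integrable (fun ω => ind i τ ω * W i c X (Θ ω)) P := fun i τ c =>
    Integrable.of_bound ((hindm _ _).mul (hWm _ _ X)).aestronglyMeasurable C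
      (Filter.Eventually.of_forall fun ω => hindWb i τ c X hX ω)
  have hWint : ∀ i c (y : Ω → ℝ), Measurable[F₀] y → (∀ ω, |y ω| ≤ 1) →
      Integrable (fun ω => y ω * W i c X (Θ ω)) P := by
    intro i c y hy hy1
    refine Integrable.of_bound (hy.mul (hWm _ _ X)).aestronglyMeasurable C
      (Filter.Eventually.of_forall fun ω => ?_)
    rw [norm_mul]
    calc _ ≤ 1 * C := mul_le_mul (hy1 _) (hWb _ _ X hX ω) (abs_nonneg _) zero_le_one
      _ = C := one_mul C
  -- pure deviations measurable with respect to own type are not profitable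
  have hpure : ∀ i (d : (Fin n → Fin (M+1)) → B),
      ∑ c, ∫ ω, (Pi.single (d (t i ω)) (1:ℝ) : B → ℝ) c * W i c X (Θ ω) ∂P
        ≤ ∑ c, ∫ ω, X ((i, t i ω), c) * W i c X (Θ ω) ∂P := by
    intro i d
    let Y : EuclideanSpace ℝ ((Fin n × (Fin n → Fin (M+1))) × B) := WithLp.toLp 2 fun a => if a.1.1 = i then (Pi.single (d a.1.2) (1:ℝ) : B → ℝ) a.2 else X a
    have hY : Y ∈ K := by
      intro a
      by_cases h : a.1 = i
      · simp only [Y, h, if_true]; exact hsing _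
      · simp only [Y, h, if_false]; exact hX a
    have h1 := hVI Y hY
    have hYi : ∀ τ c, (Y - X) ((i, τ), c) = (Pi.single (d τ) (1:ℝ) : B → ℝ) c - X ((i, τ), c) := by
      intro τ c
      rw [PiLp.sub_apply]
      simp [Y]
    have hYj : ∀ j τ c, j ≠ i → (Y - X) ((j, τ), c) = 0 := by
      intro j τ c hj
      rw [PiLp.sub_apply]
      simp [Y, hj]
    have h2 : inner ℝ (v X) (Y - X) = ∑ c, ∑ τ : (Fin n → Fin (M+1)), ∫ ω, ind i τ ω * W i c X (Θ ω) *
        ((Pi.single (d τ) (1:ℝ) : B → ℝ) c - X ((i, τ), c)) ∂P := by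
      rw [PiLp.inner_apply, Fintype.sum_prod_type, Fintype.sum_prod_type, Finset.sum_eq_single i]
      · rw [Finset.sum_comm]
        refine Finset.sum_congr rfl fun c _ => Finset.sum_congr rfl fun τ _ => ?_
        rw [integral_mul_const]
        rw [hYi]
        simp [v, mul_comm]
      · intro j _ hj
        refine Finset.sum_eq_zero fun τ _ => Finset.sum_eq_zero fun c _ => ?_
        rw [hYj j τ c hj]
        simp
      · simp
    rw [h2] at h1
    have h3 : ∀ c, ∑ τ : (Fin n → Fin (M+1)), ∫ ω, ind i τ ω * W i c X (Θ ω) *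
        ((Pi.single (d τ) (1:ℝ) : B → ℝ) c - X ((i, τ), c)) ∂P
        = ∫ ω, (Pi.single (d (t i ω)) (1:ℝ) : B → ℝ) c * W i c X (Θ ω) ∂P
          - ∫ ω, X ((i, t i ω), c) * W i c X (Θ ω) ∂P := by
      intro c
      rw [← integral_finsetSum _ (fun τ _ => (hindWint i τ c).mul_const _), ← integral_sub]
      · refine integral_congr_ae (Filter.Eventually.of_forall fun ω => ?_)
        simp only [ind]
        rw [Finset.sum_eq_single (t i ω)]
        · simp; ring
        · intro τ _ hτ
          simp [hτ.symm]
        · simp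
      · refine hWint i c _ ?_ ?_
        · exact (measurable_of_countable fun τ => (Pi.single (d τ) (1:ℝ) : B → ℝ) c).comp (htm0 i)
        · intro ω
          simp only [Pi.single_apply]; split_ifs <;> simp
      · refine hWint i c _ ?_ ?_
        · exact (measurable_of_countable fun τ => X ((i, τ), c)).comp (htm0 i)
        · intro ω
          have := mem_Icc_of_mem_stdSimplex (hX (i, t i ω)) c
          rw [abs_of_nonneg this.1]; exact this.2
    rw [Finset.sum_congr rfl (fun c _ => h3 c), Finset.sum_sub_distrib] at h1
    linarith
  refine ⟨fun j ω c => X ((j, t j ω), c), ?_, fun j ω => hX _, ?_⟩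
  · intro j c
    exact (measurable_of_countable fun τ => X ((j, τ), c)).comp (htm j)
  intro i y hym hys
  have hV : ∀ c, ∃ V : (Fin n → Fin (M+1)) → ℝ, ∀ z : Ω → ℝ, Measurable[F i] z → (∀ ω, |z ω| ≤ 1) →
      |∫ ω, z ω * W i c X (Θ ω) ∂P - ∫ ω, z ω * V (t i ω) ∂P| ≤ C * δ := by
    intro c
    obtain ⟨V, hV⟩ := ht i (fun ω => W i c X (Θ ω) / C) (by
      intro ω ω' h1 h2
      have : Θ ω = Θ ω' := by simp only [Θ, h1, h2]
      simp only [this]) (by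
      intro ω
      rw [abs_div, abs_of_pos hC, div_le_one hC]
      exact hWb i c X hX ω)
    refine ⟨fun τ => C * V τ, fun z hz hz1 => ?_⟩
    have := mul_le_mul_of_nonneg_left (hV z hz hz1) hC.le
    rw [← abs_of_pos hC, ← abs_mul, abs_of_pos hC, mul_sub, ← integral_const_mul, ← integral_const_mul] at this
    have e1 : ∀ ω, C * (z ω * (W i c X (Θ ω) / C)) = z ω * W i c X (Θ ω) := by
      intro ω; field_simp
    have e2 : ∀ ω, C * (z ω * V (t i ω)) = z ω * (C * V (t i ω)) := by
      intro ω; ring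
    simp only [e1, e2] at this
    exact this
  choose V hV using hV
  have hd : ∀ τ : (Fin n → Fin (M+1)), ∃ c0, ∀ c, V c τ ≤ V c0 τ := fun τ => Finite.exists_max fun c => V c τ
  choose d hd using hd
  have hym1 : ∀ c ω, |y ω c| ≤ 1 := by
    intro c ω
    have := mem_Icc_of_mem_stdSimplex (hys ω) c
    rw [abs_of_nonneg this.1]; exact this.2
  have hVint : ∀ c (z : Ω → ℝ), Measurable[F₀] z → (∀ ω, |z ω| ≤ 1) →
      Integrable (fun ω => z ω * V c (t i ω)) P := by
    intro c z hz hz1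
    obtain ⟨D, hD⟩ : ∃ D, ∀ τ, |V c τ| ≤ D := ⟨∑ τ, |V c τ|, fun τ =>
      Finset.single_le_sum (f := fun τ => |V c τ|) (fun _ _ => abs_nonneg _) (Finset.mem_univ τ)⟩
    refine Integrable.of_bound (hz.mul ((measurable_of_countable (V c)).comp (htm0 i))).aestronglyMeasurable D
      (Filter.Eventually.of_forall fun ω => ?_)
    rw [norm_mul]
    calc _ ≤ 1 * D := mul_le_mul (hz1 _) (hD _) (abs_nonneg _) zero_le_one
      _ = D := one_mul D
  have hdm : ∀ c, Measurable[F i] fun ω => (Pi.single (d (t i ω)) (1:ℝ) : B → ℝ) c := fun c =>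
    (measurable_of_countable fun τ => (Pi.single (d τ) (1:ℝ) : B → ℝ) c).comp (htm i)
  have hd1 : ∀ c ω, |(Pi.single (d (t i ω)) (1:ℝ) : B → ℝ) c| ≤ 1 := by
    intro c ω
    simp only [Pi.single_apply]; split_ifs <;> simp
  have hxm : ∀ c, Measurable[F₀] fun ω => X ((i, t i ω), c) := fun c =>
    (measurable_of_countable fun τ => X ((i, τ), c)).comp (htm0 i)
  have hx1 : ∀ c ω, |X ((i, t i ω), c)| ≤ 1 := by
    intro c ω
    have := mem_Icc_of_mem_stdSimplex (hX (i, t i ω)) c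
    rw [abs_of_nonneg this.1]; exact this.2
  have hym0 : ∀ c, Measurable[F₀] fun ω => y ω c := fun c => (hym c).mono (hFsub i) le_rfl
  have hdm0 := fun c => (hdm c).mono (hFsub i) le_rfl
  have hL : ∫ ω, mixedU (u i (k ω)) (Function.update (fun j c => X ((j, t j ω), c)) i (y ω)) ∂P
      = ∑ c, ∫ ω, y ω c * W i c X (Θ ω) ∂P := by
    rw [← integral_finsetSum _ (fun c _ => hWint i c _ (hym0 c) (hym1 c))]
    refine integral_congr_ae (Filter.Eventually.of_forall fun ω => ?_)
    exact mixedU_update (u i (k ω)) _ i (y ω)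
  have hR : ∫ ω, mixedU (u i (k ω)) (fun j c => X ((j, t j ω), c)) ∂P
      = ∑ c, ∫ ω, X ((i, t i ω), c) * W i c X (Θ ω) ∂P := by
    rw [← integral_finsetSum _ (fun c _ => hWint i c _ (hxm c) (hx1 c))]
    refine integral_congr_ae (Filter.Eventually.of_forall fun ω => ?_)
    have := mixedU_update (u i (k ω)) (prof X fun j => t j ω) i (fun c => X ((i, t i ω), c))
    refine Eq.trans ?_ this
    show mixedU (u i (k ω)) (fun j c => X ((j, t j ω), c)) = _
    congr 1
    funext j
    rcases eq_or_ne j i with rfl | h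
    · rw [Function.update_self]
    · rw [Function.update_of_ne h]
  have s1 : ∑ c, ∫ ω, y ω c * W i c X (Θ ω) ∂P
      ≤ ∑ c, ∫ ω, y ω c * V c (t i ω) ∂P + Fintype.card B * (C * δ) := by
    rw [← nsmul_eq_mul, ← Finset.card_univ, ← Finset.sum_const, ← Finset.sum_add_distrib]
    refine Finset.sum_le_sum fun c _ => ?_
    have := abs_le.1 (hV c _ (hym c) (hym1 c))
    linarith [this.2]
  have s2 : ∑ c, ∫ ω, (Pi.single (d (t i ω)) (1:ℝ) : B → ℝ) c * V c (t i ω) ∂P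
      ≤ ∑ c, ∫ ω, (Pi.single (d (t i ω)) (1:ℝ) : B → ℝ) c * W i c X (Θ ω) ∂P
        + Fintype.card B * (C * δ) := by
    rw [← nsmul_eq_mul, ← Finset.card_univ, ← Finset.sum_const, ← Finset.sum_add_distrib]
    refine Finset.sum_le_sum fun c _ => ?_
    have := abs_le.1 (hV c _ (hdm c) (hd1 c))
    linarith [this.1]
  have s3 : ∑ c, ∫ ω, y ω c * V c (t i ω) ∂P
      ≤ ∑ c, ∫ ω, (Pi.single (d (t i ω)) (1:ℝ) : B → ℝ) c * V c (t i ω) ∂P := by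
    rw [← integral_finsetSum _ (fun c _ => hVint c _ (hym0 c) (hym1 c)),
      ← integral_finsetSum _ (fun c _ => hVint c _ (hdm0 c) (hd1 c))]
    refine integral_mono (integrable_finsetSum _ (fun c _ => hVint c _ (hym0 c) (hym1 c)))
      (integrable_finsetSum _ (fun c _ => hVint c _ (hdm0 c) (hd1 c))) fun ω => ?_
    calc ∑ c, y ω c * V c (t i ω) ≤ ∑ c, y ω c * V (d (t i ω)) (t i ω) :=
          Finset.sum_le_sum fun c _ => mul_le_mul_of_nonneg_left (hd _ c) ((hys ω).1 c)
      _ = V (d (t i ω)) (t i ω) := by rw [← Finset.sum_mul, (hys ω).2, one_mul]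
      _ = ∑ c, (Pi.single (d (t i ω)) (1:ℝ) : B → ℝ) c * V c (t i ω) := by
        simp [Pi.single_apply]
  have s4 := hpure i d
  have hεδ : 2 * (Fintype.card B * (C * δ)) = ε := by
    rw [hδdef]; field_simp
  show ∫ ω, mixedU (u i (k ω)) (Function.update (fun j c => X ((j, t j ω), c)) i (y ω)) ∂P
    ≤ ∫ ω, mixedU (u i (k ω)) (fun j c => X ((j, t j ω), c)) ∂P + ε
  rw [hL, hR]
  linarith

end Core


section Reduction

lemma measurable_continuousMap {Ω X Y : Type*} [MeasurableSpace Ω] [TopologicalSpace X]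
    [CompactSpace X] [SecondCountableTopology X] [LocallyCompactSpace X] [Nonempty X]
    [NormedAddCommGroup Y] [SecondCountableTopology Y] [MeasurableSpace Y] [BorelSpace Y]
    [MeasurableSpace C(X, Y)] [BorelSpace C(X, Y)] (Φ : Ω → C(X, Y))
    (h : ∀ x, Measurable fun ω => Φ ω x) : Measurable Φ := by
  have hball : ∀ (g : C(X, Y)) (r : ℝ), 0 ≤ r → MeasurableSet (Φ ⁻¹' Metric.closedBall g r) := by
    intro g r hr
    have : Φ ⁻¹' Metric.closedBall g r
        = ⋂ m : ℕ, {ω | dist (Φ ω (TopologicalSpace.denseSeq X m)) (g (TopologicalSpace.denseSeq X m)) ≤ r} := by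
      ext ω
      simp only [Set.mem_preimage, Metric.mem_closedBall, Set.mem_iInter, Set.mem_setOf_eq]
      rw [ContinuousMap.dist_le hr]
      constructor
      · intro hh m; exact hh _
      · intro hh x
        have hcl : IsClosed {x | dist (Φ ω x) (g x) ≤ r} :=
          isClosed_le (by fun_prop) continuous_const
        exact (hcl.closure_subset_iff (s := Set.range (TopologicalSpace.denseSeq X))).2
          (by rintro _ ⟨m, rfl⟩; exact hh m) (TopologicalSpace.denseRange_denseSeq X x)
    rw [this]
    refine MeasurableSet.iInter fun m => ?_
    exact measurableSet_le ((h _).dist measurable_const) measurable_const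
  refine measurable_of_isOpen fun U hU => ?_
  have hr : ∀ g : C(X, Y), ∃ r > 0, g ∈ U → Metric.closedBall g r ⊆ U := by
    intro g
    by_cases hg : g ∈ U
    · obtain ⟨r, hr, hrU⟩ := Metric.nhds_basis_closedBall.mem_iff.1 (hU.mem_nhds hg)
      exact ⟨r, hr, fun _ => hrU⟩
    · exact ⟨1, one_pos, fun h => absurd h hg⟩
  choose r hr hrU using hr
  obtain ⟨s, hsU, hs, hcov⟩ := TopologicalSpace.countable_cover_nhdsWithin
    (f := fun g => Metric.closedBall g (r g)) (s := U)
    (fun g _ => mem_nhdsWithin_of_mem_nhds (Metric.closedBall_mem_nhds g (hr g)))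
  have : U = ⋃ g ∈ s, Metric.closedBall g (r g) :=
    Set.Subset.antisymm hcov (Set.iUnion₂_subset fun g hg => hrU g (hsU hg))
  rw [this, Set.preimage_iUnion₂]
  exact MeasurableSet.biUnion hs fun g _ => hball g _ (hr g).le

lemma exists_net {n : ℕ} {A : Fin n → Type*} [∀ i, MetricSpace (A i)] [∀ i, CompactSpace (A i)]
    [∀ i, Nonempty (A i)] [∀ i, MeasurableSpace (A i)] [∀ i, BorelSpace (A i)]
    (η : ℝ) (hη : 0 < η) :
    ∃ (N : ℕ) (e : ∀ j, Fin (N+1) → A j) (π : ∀ j, A j → Fin (N+1)),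
      (∀ j, Measurable (π j)) ∧ (∀ j c, e j (π j (e j c)) = e j c) ∧
      ∀ j a, dist a (e j (π j a)) < η := by
  have h1 : ∀ j, ∃ N : ℕ, ∀ a : A j, ∃ m ≤ N, dist a (TopologicalSpace.denseSeq (A j) m) < η := by
    intro j
    obtain ⟨t, ht⟩ := (isCompact_univ (X := A j)).elim_finite_subcover
      (fun m => Metric.ball (TopologicalSpace.denseSeq (A j) m) η) (fun m => Metric.isOpen_ball)
      (by
        intro a _
        obtain ⟨m, hm⟩ := (TopologicalSpace.denseRange_denseSeq (A j)).exists_dist_lt a hη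
        exact Set.mem_iUnion.2 ⟨m, hm⟩)
    refine ⟨t.sup id, fun a => ?_⟩
    obtain ⟨m, hm, ha⟩ := Set.mem_iUnion₂.1 (ht (Set.mem_univ a))
    exact ⟨m, Finset.le_sup (f := id) hm, ha⟩
  choose N' hN' using h1
  let N := Finset.univ.sup N'
  let q : ∀ j, ℕ → A j := fun j => TopologicalSpace.denseSeq (A j)
  have hnear : ∀ j (a : A j) m, m ≤ N → dist a (SimpleFunc.nearestPt (q j) N a) ≤ dist a (q j m) := by
    intro j a m hm
    have := SimpleFunc.edist_nearestPt_le (q j) a hm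
    rw [edist_dist, edist_dist, ENNReal.ofReal_le_ofReal_iff dist_nonneg] at this
    rwa [dist_comm a, dist_comm a]
  refine ⟨N, fun j c => q j c, fun j a => ⟨SimpleFunc.nearestPtInd (q j) N a,
    Nat.lt_succ_of_le (SimpleFunc.nearestPtInd_le _ _ _)⟩, ?_, ?_, ?_⟩
  · intro j
    refine measurable_to_countable' fun c => ?_
    have : (fun a => (⟨SimpleFunc.nearestPtInd (q j) N a,
        Nat.lt_succ_of_le (SimpleFunc.nearestPtInd_le _ _ _)⟩ : Fin (N+1))) ⁻¹' {c}
        = SimpleFunc.nearestPtInd (q j) N ⁻¹' {(c : ℕ)} := by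
      ext a; simp [Fin.ext_iff]
    rw [this]
    exact SimpleFunc.measurableSet_preimage _ _
  · intro j c
    have := hnear j (q j c) c (Nat.le_of_lt_succ c.2)
    rw [dist_self] at this
    exact (dist_le_zero.1 this).symm
  · intro j a
    obtain ⟨m, hm, ha⟩ := hN' j a
    exact (hnear j a m (hm.trans (Finset.le_sup (Finset.mem_univ j)))).trans_lt ha

lemma measurable_pi_measure {Ω : Type*} [MeasurableSpace Ω] {n : ℕ} {A : Fin n → Type*}
    [∀ i, MeasurableSpace (A i)] (s : ∀ j, Ω → ProbabilityMeasure (A j))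
    (hs : ∀ j, Measurable fun ω => (s j ω : Measure (A j))) :
    Measurable fun ω => Measure.pi fun j => (s j ω : Measure (A j)) := by
  refine Measurable.measure_of_isPiSystem_of_isProbabilityMeasure
    (generateFrom_pi (α := A)).symm isPiSystem_pi ?_
  rintro _ ⟨t, ht, rfl⟩
  simp only [Measure.pi_pi]
  exact Finset.measurable_prod _ fun j _ => (Measure.measurable_coe (ht j (Set.mem_univ j))).comp (hs j)

lemma integrable_payoff {Ω : Type*} [MeasurableSpace Ω] (P : Measure Ω) {n : ℕ} {A : Fin n → Type*}
    [∀ i, MetricSpace (A i)] [∀ i, CompactSpace (A i)]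
    [∀ i, Nonempty (A i)] [∀ i, MeasurableSpace (A i)] [∀ i, BorelSpace (A i)]
    (R : Ω → (∀ j, A j) → ℝ) (hR : Measurable (Function.uncurry R)) (hRc : ∀ ω, Continuous (R ω))
    (hRint : Integrable (fun ω => ⨆ a : ∀ j, A j, |R ω a|) P)
    (s : ∀ j, Ω → ProbabilityMeasure (A j))
    (hs : ∀ j, Measurable fun ω => (s j ω : Measure (A j))) :
    Integrable (fun ω => ∫ a, R ω a ∂(Measure.pi fun j => (s j ω : Measure (A j)))) P := by
  let κ : ProbabilityTheory.Kernel Ω (∀ j, A j) :=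
    ⟨fun ω => Measure.pi fun j => (s j ω : Measure (A j)), measurable_pi_measure s hs⟩
  have : ProbabilityTheory.IsMarkovKernel κ := ⟨fun ω => by
    show IsProbabilityMeasure (Measure.pi fun j => (s j ω : Measure (A j))); infer_instance⟩
  have hm : StronglyMeasurable fun ω => ∫ a, R ω a ∂(κ ω) :=
    StronglyMeasurable.integral_kernel_prod_right' (κ := κ) hR.stronglyMeasurable
  refine hRint.mono' hm.aestronglyMeasurable (Filter.Eventually.of_forall fun ω => ?_)
  have hbdd : BddAbove (Set.range fun a => |R ω a|) := isCompact_range (hRc ω).abs |>.bddAbove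
  calc ‖∫ a, R ω a ∂(Measure.pi fun j => (s j ω : Measure (A j)))‖
      ≤ (⨆ a : ∀ j, A j, |R ω a|) * (Measure.pi fun j => (s j ω : Measure (A j))).real Set.univ :=
        norm_integral_le_of_norm_le_const (Filter.Eventually.of_forall fun a => le_ciSup hbdd a)
    _ = _ := by simp

lemma payoff_approx {n : ℕ} {A : Fin n → Type*}
    [∀ i, MetricSpace (A i)] [∀ i, CompactSpace (A i)]
    [∀ i, Nonempty (A i)] [∀ i, MeasurableSpace (A i)] [∀ i, BorelSpace (A i)]
    {B : Type*} [Fintype B] [MeasurableSpace B] [DiscreteMeasurableSpace B]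
    (e : ∀ j, B → A j) (π : ∀ j, A j → B) (hπ : ∀ j, Measurable (π j))
    (f g : (∀ j, A j) → ℝ) (hf : Continuous f) (hg : Continuous g) (r δ : ℝ)
    (hfg : ∀ a, |f a - g a| ≤ r) (hδ : ∀ a, |g a - g (fun j => e j (π j (a j)))| ≤ δ)
    (s : ∀ j, ProbabilityMeasure (A j)) (p : ∀ _ : Fin n, Measure B)
    [∀ j, IsProbabilityMeasure (p j)]
    (hsp : ∀ j, (s j : Measure (A j)).map (fun a => e j (π j a)) = (p j).map (e j)) :
    |∫ a, f a ∂(Measure.pi fun j => (s j : Measure (A j)))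
      - mixedU (fun b : Fin n → B => g (fun j => e j (b j))) (fun j c => (p j).real {c})| ≤ r + δ := by
  have hem : ∀ j, Measurable (e j) := fun j => measurable_of_countable _
  have hρ : ∀ j, Measurable fun a => e j (π j a) := fun j => (hem j).comp (hπ j)
  have hρm : Measurable fun (a : ∀ j, A j) j => e j (π j (a j)) := 
    measurable_pi_lambda _ fun j => (hρ j).comp (measurable_pi_apply j)
  have hemm : Measurable fun (b : Fin n → B) j => e j (b j) := 
    measurable_pi_lambda _ fun j => (hem j).comp (measurable_pi_apply j)
  have key : ∫ a, g (fun j => e j (π j (a j))) ∂(Measure.pi fun j => (s j : Measure (A j)))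
      = mixedU (fun b : Fin n → B => g (fun j => e j (b j))) (fun j c => (p j).real {c}) := by
    have h1 : (Measure.pi fun j => (s j : Measure (A j))).map (fun (a : ∀ j, A j) j => e j (π j (a j)))
        = (Measure.pi p).map (fun (b : Fin n → B) j => e j (b j)) := by
      have : ∀ j, IsProbabilityMeasure ((s j : Measure (A j)).map (fun a => e j (π j a))) := 
        fun j => Measure.isProbabilityMeasure_map (hρ j).aemeasurable
      have : ∀ j, IsProbabilityMeasure ((p j).map (e j)) := 
        fun j => Measure.isProbabilityMeasure_map (hem j).aemeasurable
      rw [Measure.pi_map_pi (fun j => (hρ j).aemeasurable), Measure.pi_map_pi (fun j => (hem j).aemeasurable)]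
      simp only [hsp]
    rw [← integral_map (φ := fun (a : ∀ j, A j) j => e j (π j (a j))) hρm.aemeasurable 
      hg.stronglyMeasurable.aestronglyMeasurable, h1, integral_map hemm.aemeasurable 
      hg.stronglyMeasurable.aestronglyMeasurable, integral_fintype (Integrable.of_finite)]
    simp only [mixedU]
    refine Finset.sum_congr rfl fun b _ => ?_
    rw [smul_eq_mul, mul_comm, measureReal_def, Measure.pi_singleton, ENNReal.toReal_prod]
    rfl
  have hfi : Integrable f (Measure.pi fun j => (s j : Measure (A j))) := 
    (BoundedContinuousFunction.mkOfCompact ⟨f, hf⟩).integrable _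
  obtain ⟨D, hD⟩ : ∃ D, ∀ a, ‖g a‖ ≤ D :=
    ⟨_, (BoundedContinuousFunction.mkOfCompact ⟨g, hg⟩).norm_coe_le_norm⟩
  have hgi : Integrable (fun a : ∀ j, A j => g (fun j => e j (π j (a j)))) (Measure.pi fun j => (s j : Measure (A j))) := 
    Integrable.of_bound (hg.measurable.comp hρm).aestronglyMeasurable D (Filter.Eventually.of_forall fun a => hD _)
  rw [← key, ← integral_sub hfi hgi]
  have hb : ∀ a, ‖f a - g (fun j => e j (π j (a j)))‖ ≤ r + δ := by
    intro a
    have h1 := abs_le.1 (hfg a)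
    have h2 := abs_le.1 (hδ a)
    rw [Real.norm_eq_abs, abs_le]
    constructor <;> linarith [h1.1, h1.2, h2.1, h2.2]
  have := norm_integral_le_of_norm_le_const (μ := Measure.pi fun j => (s j : Measure (A j)))
    (Filter.Eventually.of_forall hb)
  simpa using this


lemma measurable_mixedU {Ω : Type*} [MeasurableSpace Ω] {n : ℕ} {B : Type*} [Fintype B]
    (k : Ω → ℕ) (hk : Measurable k) (u : ℕ → (Fin n → B) → ℝ) (p : Fin n → Ω → B → ℝ)
    (hp : ∀ j c, Measurable fun ω => p j ω c) :
    Measurable fun ω => mixedU (u (k ω)) (fun j => p j ω) := by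
  simp only [mixedU]
  refine Finset.measurable_sum _ fun b _ => Measurable.mul ?_ (Finset.measurable_prod _ fun j _ => hp j (b j))
  exact (measurable_of_countable fun m => u m b).comp hk

lemma exists_simple_approx {Ω : Type*} [MeasurableSpace Ω] (P : Measure Ω)
    {n : ℕ} {A : Fin n → Type*} [∀ i, MetricSpace (A i)] [∀ i, CompactSpace (A i)]
    [∀ i, Nonempty (A i)] [∀ i, MeasurableSpace (A i)] [∀ i, BorelSpace (A i)]
    (R : Fin n → Ω → (∀ j, A j) → ℝ)
    (hRmeas : ∀ i, Measurable (Function.uncurry (R i)))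
    (hRcont : ∀ i ω, Continuous (R i ω))
    (hRint : ∀ i, Integrable (fun ω => ⨆ a : ∀ j, A j, |R i ω a|) P)
    (δ : ℝ) (hδ : 0 < δ) :
    ∃ (g : SimpleFunc Ω C(∀ j, A j, Fin n → ℝ)) (r : Ω → ℝ), Integrable r P ∧ ∫ ω, r ω ∂P ≤ δ ∧
      ∀ i ω a, |R i ω a - g ω a i| ≤ r ω := by
  borelize C(∀ j, A j, Fin n → ℝ)
  let Φ : Ω → C(∀ j, A j, Fin n → ℝ) := fun ω => ⟨fun a i => R i ω a, continuous_pi fun i => hRcont i ω⟩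
  have hΦ : Measurable Φ := by
    refine measurable_continuousMap Φ fun a => measurable_pi_lambda _ fun i => ?_
    exact (hRmeas i).comp (measurable_id.prodMk measurable_const)
  have hΦi : Integrable Φ P := by
    refine (integrable_finsetSum Finset.univ fun i _ => hRint i).mono' hΦ.aestronglyMeasurable
      (Filter.Eventually.of_forall fun ω => ?_)
    have h0 : ∀ i, 0 ≤ ⨆ a : ∀ j, A j, |R i ω a| := fun i => Real.iSup_nonneg fun a => abs_nonneg _
    rw [ContinuousMap.norm_le _ (Finset.sum_nonneg fun i _ => h0 i)]
    intro a
    rw [pi_norm_le_iff_of_nonneg (Finset.sum_nonneg fun i _ => h0 i)]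
    intro i
    have hbdd : BddAbove (Set.range fun a => |R i ω a|) := (isCompact_range (hRcont i ω).abs).bddAbove
    exact (le_ciSup hbdd a).trans (Finset.single_le_sum (f := fun i => ⨆ a : ∀ j, A j, |R i ω a|)
      (fun i _ => h0 i) (Finset.mem_univ i))
  obtain ⟨g, hg, hgm⟩ := (memLp_one_iff_integrable.2 hΦi).exists_simpleFunc_eLpNorm_sub_lt
    ENNReal.one_ne_top (ε := ENNReal.ofReal δ) (by simpa using hδ)
  have hi : Integrable (fun ω => Φ ω - g ω) P := hΦi.sub (memLp_one_iff_integrable.1 hgm)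
  refine ⟨g, fun ω => ‖Φ ω - g ω‖, hi.norm, ?_, ?_⟩
  · rw [integral_norm_eq_lintegral_enorm hi.aestronglyMeasurable]
    refine ENNReal.toReal_le_of_le_ofReal hδ.le ?_
    rw [eLpNorm_one_eq_lintegral_enorm] at hg
    exact hg.le
  · intro i ω a
    exact (norm_le_pi_norm ((Φ ω - g ω) a) i).trans ((Φ ω - g ω).norm_coe_le_norm a)

lemma weights_real {B : Type*} [Fintype B] [MeasurableSpace B] [DiscreteMeasurableSpace B]
    (x : B → ℝ) (hx : x ∈ stdSimplex ℝ B) (c : B) :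
    (∑ c, ENNReal.ofReal (x c) • Measure.dirac c).real {c} = x c := by
  classical
  rw [measureReal_def, Measure.finsetSum_apply, Finset.sum_eq_single c]
  · simp [hx.1 c]
  · intro d _ hd
    simp [hd]
  · simp

lemma weights_prob {B : Type*} [Fintype B] [MeasurableSpace B] [DiscreteMeasurableSpace B]
    (x : B → ℝ) (hx : x ∈ stdSimplex ℝ B) :
    IsProbabilityMeasure (∑ c, ENNReal.ofReal (x c) • Measure.dirac c) := by
  constructor
  rw [Measure.finsetSum_apply]
  simp only [Measure.smul_apply, measure_univ, smul_eq_mul, mul_one]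
  rw [← ENNReal.ofReal_sum_of_nonneg fun c _ => hx.1 c, hx.2, ENNReal.ofReal_one]

lemma weights_meas {Ω : Type*} [MeasurableSpace Ω] {B : Type*} [Fintype B] [MeasurableSpace B]
    (x : Ω → B → ℝ) (hx : ∀ c, Measurable fun ω => x ω c) :
    Measurable fun ω => ∑ c, ENNReal.ofReal (x ω c) • Measure.dirac c := by
  refine Measure.measurable_of_measurable_coe _ fun s _ => ?_
  simp only [Measure.finsetSum_apply, Measure.smul_apply, smul_eq_mul]
  exact Finset.measurable_sum _ fun c _ => (hx c).ennreal_ofReal.mul_const _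

lemma probMeasure_simplex {B : Type*} [Fintype B] [MeasurableSpace B] [DiscreteMeasurableSpace B]
    (p : Measure B) [IsProbabilityMeasure p] : (fun c => p.real {c}) ∈ stdSimplex ℝ B := by
  refine ⟨fun c => measureReal_nonneg, ?_⟩
  rw [sum_measureReal_singleton]
  simp

end Reduction

/-- Part 2 of the main theorem: every Bayesian game with finitely many players, nested
information, compact metric action spaces, and payoffs that are measurable, continuous in
the action profile, and satisfy `E[max_a |R_i(a)|] < ∞`, admits a Harsanyi `ε`-equilibrium
for every `ε > 0`. -/
theorem exists_harsanyi_eps_equilibrium_nested_info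
    {Ω : Type*} {F₀ : MeasurableSpace Ω} (P : Measure Ω) [IsProbabilityMeasure P]
    {n : ℕ} (hn : 2 ≤ n)
    (F : Fin n → MeasurableSpace Ω) (hFsub : ∀ i, F i ≤ F₀)
    (hnested : ∀ i j : Fin n, i ≤ j → F j ≤ F i)
    {A : Fin n → Type*} [∀ i, MetricSpace (A i)] [∀ i, CompactSpace (A i)]
    [∀ i, Nonempty (A i)] [∀ i, MeasurableSpace (A i)] [∀ i, BorelSpace (A i)]
    (R : Fin n → Ω → (∀ j, A j) → ℝ)
    (hRmeas : ∀ i, Measurable (Function.uncurry (R i)))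
    (hRcont : ∀ i ω, Continuous (R i ω))
    (hRint : ∀ i, Integrable (fun ω => ⨆ a : ∀ j, A j, |R i ω a|) P)
    (ε : ℝ) (hε : 0 < ε) :
    ∃ sstar : ∀ j, Ω → ProbabilityMeasure (A j),
      (∀ j, Measurable[F j] fun ω => (sstar j ω : Measure (A j))) ∧
      ∀ i, ∀ si : Ω → ProbabilityMeasure (A i),
        (Measurable[F i] fun ω => (si ω : Measure (A i))) →
        exAntePayoff P R (Function.update sstar i si) i ≤ exAntePayoff P R sstar i + ε := by
  classical
  set δ : ℝ := ε / 8 with hδdef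
  have hδ : 0 < δ := by positivity
  obtain ⟨g, r, hri, hrδ, hgr⟩ := exists_simple_approx P R hRmeas hRcont hRint δ hδ
  -- common modulus of continuity
  obtain ⟨η, hη, hmod⟩ : ∃ η > 0, ∀ ω, ∀ a b : ∀ j, A j, dist a b < η → dist (g ω a) (g ω b) < δ := by
    let G : (∀ j, A j) → (g.range → Fin n → ℝ) := fun a d => d.1 a
    have hG : Continuous G := continuous_pi fun d => d.1.continuous
    obtain ⟨η, hη, h⟩ := Metric.uniformContinuous_iff.1
      (CompactSpace.uniformContinuous_of_continuous hG) δ hδ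
    refine ⟨η, hη, fun ω a b hab => ?_⟩
    exact (dist_le_pi_dist (G a) (G b) ⟨g ω, SimpleFunc.mem_range_self g ω⟩).trans_lt (h hab)
  obtain ⟨N, e, π, hπ, heπ, hdist⟩ := exists_net (A := A) η hη
  -- encoding of the finite range
  obtain ⟨f, hf⟩ := Set.countable_iff_exists_injOn.1 (g.range.countable_toSet)
  let dec : ℕ → C(∀ j, A j, Fin n → ℝ) := Function.invFunOn f (g.range : Set _)
  let k : Ω → ℕ := fun ω => f (g ω)
  have hdec : ∀ ω, dec (k ω) = g ω := fun ω =>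
    hf.leftInvOn_invFunOn (Finset.mem_coe.2 (SimpleFunc.mem_range_self g ω))
  have hk : Measurable[F₀] k := (g.map f).measurable
  have hkS : ∀ ω, k ω ∈ (g.map f).range := fun ω => SimpleFunc.mem_range_self (g.map f) ω
  let u : Fin n → ℕ → (Fin n → Fin (N+1)) → ℝ := fun i m b => dec m (fun j => e j (b j)) i
  obtain ⟨C, hC⟩ := g.exists_forall_norm_le
  have hu : ∀ i ω b, |u i (k ω) b| ≤ |C| + 1 := by
    intro i ω b
    have h1 : |u i (k ω) b| ≤ ‖g ω‖ := by
      simp only [u, hdec]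
      exact (norm_le_pi_norm (g ω fun j => e j (b j)) i).trans ((g ω).norm_coe_le_norm _)
    linarith [hC ω, le_abs_self C]
  have hCpos : 0 < |C| + 1 := by positivity
  obtain ⟨x, hxm, hxs, hx⟩ := core P F hFsub hnested k hk _ hkS u (|C| + 1) hCpos hu (ε / 2) (by positivity)
  -- comparison of the payoffs
  have hcomp : ∀ i (s : ∀ j, Ω → ProbabilityMeasure (A j)),
      (∀ j, Measurable[F₀] fun ω => (s j ω : Measure (A j))) →
      ∀ p : Fin n → Ω → Measure (Fin (N+1)), (∀ j ω, IsProbabilityMeasure (p j ω)) →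
      (∀ j c, Measurable[F₀] fun ω => (p j ω).real {c}) →
      (∀ j ω, (s j ω : Measure (A j)).map (fun a => e j (π j a)) = (p j ω).map (e j)) →
      |exAntePayoff P R s i - ∫ ω, mixedU (u i (k ω)) (fun j c => (p j ω).real {c}) ∂P| ≤ 2 * δ := by
    intro i s hs p hp hpm hsp
    have hI := integrable_payoff P (R i) (hRmeas i) (hRcont i) (hRint i) s hs
    have hM : Integrable (fun ω => mixedU (u i (k ω)) (fun j c => (p j ω).real {c})) P := by
      refine Integrable.of_bound (measurable_mixedU k hk (u i) (fun j ω c => (p j ω).real {c})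
        hpm).aestronglyMeasurable (|C| + 1) (Filter.Eventually.of_forall fun ω => ?_)
      exact abs_mixedU_le _ _ _ (hu i ω) fun j => probMeasure_simplex (p j ω)
    have hpt : ∀ ω, |∫ a, R i ω a ∂(Measure.pi fun j => (s j ω : Measure (A j)))
        - mixedU (u i (k ω)) (fun j c => (p j ω).real {c})| ≤ r ω + δ := by
      intro ω
      have := payoff_approx e π hπ (R i ω) (fun a => g ω a i) (hRcont i ω)
        ((continuous_apply i).comp (g ω).continuous) (r ω) δ (hgr i ω) (by
          intro a
          have h1 : dist a (fun j => e j (π j (a j))) < η :=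
            (dist_pi_lt_iff hη).2 fun j => hdist j (a j)
          exact (dist_le_pi_dist _ _ i).trans (hmod ω _ _ h1).le) (fun j => s j ω) (fun j => p j ω)
          (fun j => hsp j ω)
      simp only [u, hdec]
      exact this
    unfold exAntePayoff
    rw [← integral_sub hI hM]
    calc _ ≤ ∫ ω, |∫ a, R i ω a ∂(Measure.pi fun j => (s j ω : Measure (A j)))
        - mixedU (u i (k ω)) (fun j c => (p j ω).real {c})| ∂P := abs_integral_le_integral_abs
      _ ≤ ∫ ω, (r ω + δ) ∂P := integral_mono (hI.sub hM).abs (hri.add (integrable_const δ)) hpt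
      _ = ∫ ω, r ω ∂P + δ := by rw [integral_add hri (integrable_const δ)]; simp
      _ ≤ 2 * δ := by linarith
  let pm : Fin n → Ω → Measure (Fin (N+1)) := fun j ω => ∑ c, ENNReal.ofReal (x j ω c) • Measure.dirac c
  have hpm1 : ∀ j ω, IsProbabilityMeasure (pm j ω) := fun j ω => weights_prob _ (hxs j ω)
  have hpmr : ∀ j ω c, (pm j ω).real {c} = x j ω c := fun j ω c => weights_real _ (hxs j ω) c
  have hem : ∀ j, Measurable (e j) := fun j => measurable_of_countable _
  have hρ : ∀ j, Measurable fun a => e j (π j a) := fun j => (hem j).comp (hπ j)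
  let sstar : ∀ j, Ω → ProbabilityMeasure (A j) := fun j ω =>
    ⟨(pm j ω).map (e j), Measure.isProbabilityMeasure_map (hem j).aemeasurable⟩
  have hsm : ∀ j, Measurable[F j] fun ω => (sstar j ω : Measure (A j)) := by
    intro j
    have h1 : Measurable[F j] (pm j) := by
      letI := F j
      exact weights_meas (x j) (hxm j)
    exact (Measure.measurable_map (e j) (hem j)).comp h1
  have hsm0 : ∀ j, Measurable[F₀] fun ω => (sstar j ω : Measure (A j)) := fun j =>
    (hsm j).mono (hFsub j) le_rfl
  have hspstar : ∀ j ω, (sstar j ω : Measure (A j)).map (fun a => e j (π j a)) = (pm j ω).map (e j) := by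
    intro j ω
    show ((pm j ω).map (e j)).map (fun a => e j (π j a)) = _
    rw [Measure.map_map (hρ j) (hem j)]
    congr 1
    funext c
    exact heπ j c
  refine ⟨sstar, hsm, fun i si hsi => ?_⟩
  have hsi0 : Measurable[F₀] fun ω => (si ω : Measure (A i)) := hsi.mono (hFsub i) le_rfl
  have hstar := hcomp i sstar hsm0 pm hpm1 (fun j c => by
    simp only [hpmr]; exact (hxm j c).mono (hFsub j) le_rfl) hspstar
  simp only [hpmr] at hstar
  -- the deviation
  let q : Ω → Measure (Fin (N+1)) := fun ω => (si ω : Measure (A i)).map (π i)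
  have hq1 : ∀ ω, IsProbabilityMeasure (q ω) := fun ω =>
    Measure.isProbabilityMeasure_map (hπ i).aemeasurable
  have hqm : ∀ c, Measurable[F i] fun ω => (q ω).real {c} := by
    intro c
    have h1 : Measurable[F i] q := (Measure.measurable_map (π i) (hπ i)).comp hsi
    exact ((Measure.measurable_coe (MeasurableSet.singleton c)).comp h1).ennreal_toReal
  have hdev := hcomp i (Function.update sstar i si) (by
      intro j
      rcases eq_or_ne j i with rfl | h
      · simpa only [Function.update_self] using hsi0
      · simpa only [Function.update_of_ne h] using hsm0 j)
    (Function.update pm i q) (by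
      intro j ω
      rcases eq_or_ne j i with rfl | h
      · rw [Function.update_self]; exact hq1 ω
      · rw [Function.update_of_ne h]; exact hpm1 j ω)
    (by
      intro j c
      rcases eq_or_ne j i with rfl | h
      · simp only [Function.update_self]; exact (hqm c).mono (hFsub j) le_rfl
      · simp only [Function.update_of_ne h, hpmr]; exact (hxm j c).mono (hFsub j) le_rfl)
    (by
      intro j ω
      rcases eq_or_ne j i with rfl | h
      · simp only [Function.update_self, q]
        rw [Measure.map_map (hem j) (hπ j)]
        rfl
      · simp only [Function.update_of_ne h]; exact hspstar j ω)
  have hprof : ∀ ω, (fun j c => (Function.update pm i q j ω).real {c})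
      = Function.update (fun j => x j ω) i (fun c => (q ω).real {c}) := by
    intro ω
    funext j
    rcases eq_or_ne j i with rfl | h
    · simp only [Function.update_self]
    · simp only [Function.update_of_ne h, hpmr]
  simp only [hprof] at hdev
  have hfin := hx i (fun ω c => (q ω).real {c}) hqm (fun ω => probMeasure_simplex (q ω))
  have h1 := (abs_le.1 hstar).1
  have h2 := (abs_le.1 hdev).2
  have h3 : ∫ ω, mixedU (u i (k ω)) (fun j => x j ω) ∂P
      = ∫ ω, mixedU (u i (k ω)) (fun j c => x j ω c) ∂P := rfl
  linarith
end
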